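/- arXiv:1307.0046 — 2 statements merged into one kernel-verified Lean document; each statement's English description precedes it below -/
import Mathlib

section
/- Let μ, ν ∈ ℝ and let f : [0,∞) → ℝ be continuously differentiable with f and f' bounded and f(x) → 0 as x → ∞. Then there exists a solution u of the Stroock–Williams problem with parameters μ, ν and initial data f. -/
open MeasureTheory Set Filter

/-- Standard normal density. -/
noncomputable def phi (x : ℝ) : ℝ := (1 / Real.sqrt (2 * Real.pi)) * Real.exp (-x ^ 2 / 2)

/-- Standard normal tail function. -/
noncomputable def Psi (x : ℝ) : ℝ := ∫ y in Set.Ioi x, phi y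

/-- The kernel `G(t;x,y)` with drift parameter `μ`. -/
noncomputable def Gker (μ t x y : ℝ) : ℝ :=
  (1 / Real.sqrt t) *
      (Real.exp (2 * μ * y) * phi ((x + y + μ * t) / Real.sqrt t) +
        phi ((x - y + μ * t) / Real.sqrt t)) -
    2 * μ * Real.exp (2 * μ * y) * Psi ((x + y + μ * t) / Real.sqrt t)

/-- The kernel `H(t;x,y)` with parameters `μ, ν`. -/
noncomputable def Hker (μ ν t x y : ℝ) : ℝ :=
  if ν = μ then
    2 * Real.exp (2 * μ * y) *
      ((1 + μ * (x + y + μ * t)) * Psi ((x + y + μ * t) / Real.sqrt t) -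
        μ * Real.sqrt t * phi ((x + y + μ * t) / Real.sqrt t))
  else
    Real.exp (2 * μ * y) / (ν - μ) *
      ((2 * ν - μ) * Real.exp (2 * (ν - μ) * (x + y + ν * t)) *
          Psi ((x + y + (2 * ν - μ) * t) / Real.sqrt t) -
        μ * Psi ((x + y + μ * t) / Real.sqrt t))

/-- The density `g(t;b,s)` of `(B_t^{-μ}, S_t^{-μ})`, vanishing off `{b ≤ s, 0 ≤ s}`. -/
noncomputable def gker (μ t b s : ℝ) : ℝ :=
  if b ≤ s ∧ 0 ≤ s then
    Real.sqrt (2 / Real.pi) * t ^ (-(3 : ℝ) / 2) * (2 * s - b) *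
      Real.exp (-(2 * s - b) ^ 2 / (2 * t) - μ * (b + μ * t / 2))
  else 0

/-- Spatial derivative (one-sided at `x = 0`). -/
noncomputable def ux (u : ℝ → ℝ → ℝ) (t x : ℝ) : ℝ :=
  derivWithin (fun z => u t z) (Set.Ici 0) x

/-- Second spatial derivative (one-sided at `x = 0`). -/
noncomputable def uxx (u : ℝ → ℝ → ℝ) (t x : ℝ) : ℝ :=
  derivWithin (fun z => ux u t z) (Set.Ici 0) x

/-- Time derivative. -/
noncomputable def ut (u : ℝ → ℝ → ℝ) (t x : ℝ) : ℝ :=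
  deriv (fun s => u s x) t

/-- `u` is a solution of the Stroock–Williams problem with parameters `μ, ν`
and initial data `f`. -/
def IsSWSolution (μ ν : ℝ) (f : ℝ → ℝ) (u : ℝ → ℝ → ℝ) : Prop :=
  ContDiffOn ℝ (⊤ : ℕ∞) (fun p : ℝ × ℝ => u p.1 p.2) (Set.Ioi 0 ×ˢ Set.Ici 0) ∧
  (∀ T > (0 : ℝ),
    ContinuousOn (fun p : ℝ × ℝ => u p.1 p.2) (Set.Icc 0 T ×ˢ Set.Ici 0) ∧
    ContinuousOn (fun p : ℝ × ℝ => ux u p.1 p.2) (Set.Icc 0 T ×ˢ Set.Ici 0) ∧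
    ∃ C : ℝ, ∀ p ∈ Set.Icc (0 : ℝ) T ×ˢ Set.Ici (0 : ℝ),
      |u p.1 p.2| ≤ C ∧ |ux u p.1 p.2| ≤ C) ∧
  (∀ t > (0 : ℝ), Filter.Tendsto (fun x => u t x) Filter.atTop (nhds 0)) ∧
  (∀ t > (0 : ℝ), ∀ x ≥ (0 : ℝ), ut u t x = μ * ux u t x + (1 / 2) * uxx u t x) ∧
  (∀ x ≥ (0 : ℝ), u 0 x = f x) ∧
  (∀ t > (0 : ℝ), ut u t 0 = ν * ux u t 0)

/-- `f` is admissible initial data: `C¹` on `[0,∞)` with `f` and `f'` bounded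
and `f(x) → 0` as `x → ∞`. -/
def IsInitialData (f : ℝ → ℝ) : Prop :=
  ContDiffOn ℝ 1 f (Set.Ici 0) ∧
  (∃ C : ℝ, ∀ x ∈ Set.Ici (0 : ℝ), |f x| ≤ C ∧ |derivWithin f (Set.Ici 0) x| ≤ C) ∧
  Filter.Tendsto f Filter.atTop (nhds 0)


open ProbabilityTheory Topology

/-- A continuous function on `ℝ` of at most exponential growth. -/
structure ContinuousExpGrowth (g : ℝ → ℝ) : Prop where
  cont : Continuous g
  growth : ∃ C A : ℝ, 0 ≤ A ∧ ∀ y, |g y| ≤ C * Real.exp (A * |y|)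

namespace ContinuousExpGrowth

variable {g h : ℝ → ℝ}

theorem of_bounded (hg : Continuous g) {C : ℝ} (hC : ∀ y, |g y| ≤ C) :
    ContinuousExpGrowth g :=
  ⟨hg, C, 0, le_rfl, fun y => by simpa using hC y⟩

theorem const (c : ℝ) : ContinuousExpGrowth fun _ => c :=
  of_bounded continuous_const fun _ => le_rfl

theorem id : ContinuousExpGrowth fun y => y :=
  ⟨continuous_id, 1, 1, zero_le_one, fun y => by
    linarith [Real.add_one_le_exp (1 * |y|)]⟩

theorem exp_mul (a : ℝ) : ContinuousExpGrowth fun y => Real.exp (a * y) :=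
  ⟨by fun_prop, 1, |a|, abs_nonneg a, fun y => by
    rw [abs_of_pos (Real.exp_pos _), one_mul, ← abs_mul]
    exact Real.exp_le_exp.2 (le_abs_self _)⟩

theorem coeff_nonneg {C A : ℝ} (hC : ∀ y, |g y| ≤ C * Real.exp (A * |y|)) : 0 ≤ C := by
  simpa using (abs_nonneg _).trans (hC 0)

theorem add (hg : ContinuousExpGrowth g) (hh : ContinuousExpGrowth h) :
    ContinuousExpGrowth fun y => g y + h y := by
  obtain ⟨C, A, hA, hC⟩ := hg.growth
  obtain ⟨D, B, hB, hD⟩ := hh.growth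
  refine ⟨hg.cont.add hh.cont, C + D, A + B, add_nonneg hA hB, fun y => ?_⟩
  have h1 : C * Real.exp (A * |y|) ≤ C * Real.exp ((A + B) * |y|) := by
    have := coeff_nonneg hC
    gcongr
    linarith
  have h2 : D * Real.exp (B * |y|) ≤ D * Real.exp ((A + B) * |y|) := by
    have := coeff_nonneg hD
    gcongr
    linarith
  linarith [abs_add_le (g y) (h y), hC y, hD y]

theorem mul (hg : ContinuousExpGrowth g) (hh : ContinuousExpGrowth h) :
    ContinuousExpGrowth fun y => g y * h y := by
  obtain ⟨C, A, hA, hC⟩ := hg.growth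
  obtain ⟨D, B, hB, hD⟩ := hh.growth
  refine ⟨hg.cont.mul hh.cont, C * D, A + B, add_nonneg hA hB, fun y => ?_⟩
  calc |g y * h y| = |g y| * |h y| := abs_mul _ _
    _ ≤ (C * Real.exp (A * |y|)) * (D * Real.exp (B * |y|)) :=
      mul_le_mul (hC y) (hD y) (abs_nonneg _) ((abs_nonneg _).trans (hC y))
    _ = C * D * Real.exp ((A + B) * |y|) := by
      rw [add_mul, Real.exp_add]; ring

theorem comp_neg (hg : ContinuousExpGrowth g) : ContinuousExpGrowth fun y => g (-y) := by
  obtain ⟨C, A, hA, hC⟩ := hg.growth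
  exact ⟨hg.cont.comp continuous_neg, C, A, hA, fun y => by simpa using hC (-y)⟩

theorem primitive (hg : ContinuousExpGrowth g) :
    ContinuousExpGrowth fun y => ∫ s in (0 : ℝ)..y, g s := by
  obtain ⟨C, A, hA, hC⟩ := hg.growth
  have h0 := coeff_nonneg hC
  refine ⟨intervalIntegral.continuous_primitive (fun a b => hg.cont.intervalIntegrable a b) 0,
    C, A + 1, by linarith, fun y => ?_⟩
  have h1 : ‖∫ s in (0 : ℝ)..y, g s‖ ≤ C * Real.exp (A * |y|) * |y - 0| := by
    refine intervalIntegral.norm_integral_le_of_norm_le_const fun s hs => (hC s).trans ?_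
    have : |s| ≤ |y| := by
      rcases le_total 0 y with hy | hy
      · rw [uIoc_of_le hy] at hs
        rw [abs_of_pos hs.1, abs_of_nonneg hy]; exact hs.2
      · rw [uIoc_of_ge hy] at hs
        rw [abs_of_nonpos hs.2, abs_of_nonpos hy]; linarith [hs.1]
    gcongr
  rw [sub_zero, Real.norm_eq_abs] at h1
  refine h1.trans ?_
  rw [add_mul, Real.exp_add, ← mul_assoc, one_mul]
  gcongr
  linarith [Real.add_one_le_exp |y|]

theorem ite_le (hg : ContinuousExpGrowth g) (hh : ContinuousExpGrowth h) (h0 : g 0 = h 0) :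
    ContinuousExpGrowth fun y => if 0 ≤ y then g y else h y := by
  obtain ⟨C, A, hA, hC⟩ := hg.growth
  obtain ⟨D, B, hB, hD⟩ := hh.growth
  refine ⟨Continuous.if_le hg.cont hh.cont continuous_const continuous_id
    (fun y hy => by rw [← hy]; exact h0), C + D, A + B, add_nonneg hA hB, fun y => ?_⟩
  have hC0 := coeff_nonneg hC
  have hD0 := coeff_nonneg hD
  split_ifs
  · refine (hC y).trans ?_
    gcongr <;> linarith
  · refine (hD y).trans ?_
    gcongr <;> linarith

theorem le_exp_max (hg : ContinuousExpGrowth g) {B : ℝ} (hB : ∀ y, 0 ≤ y → |g y| ≤ B) :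
    ∃ C A : ℝ, 0 ≤ C ∧ 0 ≤ A ∧ ∀ y, |g y| ≤ C * Real.exp (A * max (-y) 0) := by
  obtain ⟨C, A, hA, hC⟩ := hg.growth
  refine ⟨max B C, A, (coeff_nonneg hC).trans (le_max_right _ _), hA, fun y => ?_⟩
  rcases le_total 0 y with hy | hy
  · rw [max_eq_right (neg_nonpos.2 hy)]
    simpa only [mul_zero, Real.exp_zero, mul_one] using (hB y hy).trans (le_max_left B C)
  · rw [max_eq_left (neg_nonneg.2 hy), ← abs_of_nonpos hy]
    exact (hC y).trans (mul_le_mul_of_nonneg_right (le_max_right _ _) (Real.exp_pos _).le)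

theorem integrable_gaussian (hg : ContinuousExpGrowth g) (m : ℝ) (v : NNReal) :
    Integrable g (gaussianReal m v) := by
  obtain ⟨C, A, -, hC⟩ := hg.growth
  refine Integrable.mono' ((integrable_exp_mul_abs (X := fun y => y) (t := A)
    (integrable_exp_mul_gaussianReal A) (integrable_exp_mul_gaussianReal (-A))).const_mul C)
    hg.cont.aestronglyMeasurable (ae_of_all _ hC)

theorem comp_affine (hg : ContinuousExpGrowth g) (m s : ℝ) :
    ContinuousExpGrowth fun z => g (m + s * z) := by
  obtain ⟨C, A, hA, hC⟩ := hg.growth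
  have h0 := coeff_nonneg hC
  refine ⟨hg.cont.comp (by fun_prop), C * Real.exp (A * |m|), A * |s|, by positivity,
    fun z => (hC _).trans ?_⟩
  rw [mul_assoc, ← Real.exp_add]
  have : |m + s * z| ≤ |m| + |s| * |z| := by
    rw [← abs_mul]; exact abs_add_le _ _
  gcongr
  nlinarith

/-- A bound on `g (m + s * z)` that is uniform for `m` and `s` in a bounded set. -/
theorem affine_bound (hg : ContinuousExpGrowth g) (M : ℝ) :
    ∃ b : ℝ → ℝ, ContinuousExpGrowth b ∧
      ∀ m s z, |m| ≤ M → |s| ≤ M → |g (m + s * z)| ≤ b z := by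
  obtain ⟨C, A, hA, hC⟩ := hg.growth
  have h0 := coeff_nonneg hC
  rcases lt_or_ge M 0 with hM | hM
  · exact ⟨fun _ => 0, const 0, fun m s z hm _ =>
      absurd ((abs_nonneg m).trans hm) (not_le.2 hM)⟩
  refine ⟨fun z => C * Real.exp (A * (M + M * |z|)), ⟨by fun_prop, C * Real.exp (A * M), A * M,
    by positivity, fun z => ?_⟩, fun m s z hm hs => (hC _).trans ?_⟩
  · rw [abs_of_nonneg (by positivity), mul_assoc, ← Real.exp_add]
    apply le_of_eq; ring_nf
  · have : |m + s * z| ≤ M + M * |z| := by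
      refine (abs_add_le _ _).trans ?_
      rw [abs_mul]
      gcongr
    beta_reduce
    gcongr

theorem integrable_mul_exp_quadratic (hg : ContinuousExpGrowth g) {a : ℝ} (ha : 0 < a) (b : ℝ) :
    Integrable fun y => g y * Real.exp (b * y - a * y ^ 2) := by
  obtain ⟨C, A, hA, hC⟩ := (hg.mul (exp_mul b)).growth
  have h0 := coeff_nonneg hC
  refine Integrable.mono' ((integrable_exp_neg_mul_sq (half_pos ha)).const_mul
    (C * Real.exp (A ^ 2 / (2 * a)))) (hg.cont.mul (by fun_prop)).aestronglyMeasurable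
    (ae_of_all _ fun y => ?_)
  rw [sub_eq_add_neg, Real.exp_add, ← mul_assoc, norm_mul, Real.norm_eq_abs, Real.norm_eq_abs,
    abs_of_pos (Real.exp_pos (-(a * y ^ 2)))]
  refine (mul_le_mul_of_nonneg_right (hC y) (Real.exp_pos _).le).trans ?_
  rw [mul_assoc, mul_assoc, ← Real.exp_add, ← Real.exp_add]
  refine mul_le_mul_of_nonneg_left (Real.exp_le_exp.2 ?_) h0
  have : A * |y| ≤ A ^ 2 / (2 * a) + a / 2 * |y| ^ 2 := by
    have h1 : A ^ 2 / (2 * a) + a / 2 * |y| ^ 2 - A * |y| = (A - a * |y|) ^ 2 / (2 * a) := by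
      field_simp; ring
    have h2 : 0 ≤ (A - a * |y|) ^ 2 / (2 * a) := by positivity
    linarith
  rw [sq_abs] at this
  linarith

end ContinuousExpGrowth

/-- The two-parameter Laplace-type transform `(a, b) ↦ ∫ g(y) exp(b y - a y²) dy`. -/
noncomputable def quadLaplace (g : ℝ → ℝ) (p : ℝ × ℝ) : ℝ :=
  ∫ y, g y * Real.exp (p.2 * y - p.1 * y ^ 2)

/-- The Gaussian average of `g` with mean `m` and standard deviation `s`. -/
noncomputable def gaussAvg (g : ℝ → ℝ) (m s : ℝ) : ℝ :=
  ∫ z, g (m + s * z) ∂gaussianReal 0 1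

namespace ContinuousExpGrowth

variable {g : ℝ → ℝ}

theorem hasFDerivAt_quadLaplace (hg : ContinuousExpGrowth g) {p : ℝ × ℝ} (hp : 0 < p.1) :
    HasFDerivAt (quadLaplace g)
      (quadLaplace (fun y => y * g y) p • ContinuousLinearMap.snd ℝ ℝ ℝ -
        quadLaplace (fun y => y * (y * g y)) p • ContinuousLinearMap.fst ℝ ℝ ℝ) p := by
  have hg1 : ContinuousExpGrowth fun y => y * g y := ContinuousExpGrowth.id.mul hg
  have hg2 : ContinuousExpGrowth fun y => y * (y * g y) := ContinuousExpGrowth.id.mul hg1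
  set D : ℝ × ℝ → ℝ → ℝ × ℝ →L[ℝ] ℝ := fun q y =>
    (y * g y * Real.exp (q.2 * y - q.1 * y ^ 2)) • ContinuousLinearMap.snd ℝ ℝ ℝ -
      (y * (y * g y) * Real.exp (q.2 * y - q.1 * y ^ 2)) • ContinuousLinearMap.fst ℝ ℝ ℝ with hD
  have hint : ∫ y, D p y = quadLaplace (fun y => y * g y) p • ContinuousLinearMap.snd ℝ ℝ ℝ -
      quadLaplace (fun y => y * (y * g y)) p • ContinuousLinearMap.fst ℝ ℝ ℝ := by
    rw [hD, integral_sub, integral_smul_const, integral_smul_const]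
    · rfl
    · exact (hg1.integrable_mul_exp_quadratic hp _).smul_const _
    · exact (hg2.integrable_mul_exp_quadratic hp _).smul_const _
  rw [← hint]
  set B := |p.2| + 1 with hB
  let G : ℝ → ℝ := fun y => (|y * g y| + |y * (y * g y)|) *
    (Real.exp (B * y) + Real.exp (-B * y))
  have habs : ∀ {k : ℝ → ℝ}, ContinuousExpGrowth k → ContinuousExpGrowth fun y => |k y| := by
    rintro k ⟨hk, C, A, hA, hC⟩
    exact ⟨hk.abs, C, A, hA, fun y => by simpa using hC y⟩
  have hG : ContinuousExpGrowth G :=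
    ((habs hg1).add (habs hg2)).mul ((exp_mul B).add (exp_mul (-B)))
  have hs : {q : ℝ × ℝ | p.1 / 2 < q.1 ∧ |q.2| < B} ∈ 𝓝 p := by
    refine IsOpen.mem_nhds ?_ ⟨by linarith, by linarith⟩
    exact (isOpen_lt continuous_const continuous_fst).inter
      (isOpen_lt (continuous_snd.abs) continuous_const)
  refine hasFDerivAt_integral_of_dominated_of_fderiv_le (F' := D)
    (bound := fun y => G y * Real.exp (0 * y - p.1 / 2 * y ^ 2)) hs
    (Eventually.of_forall fun q => (hg.cont.mul (by fun_prop)).aestronglyMeasurable)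
    (hg.integrable_mul_exp_quadratic hp _) ?_ (ae_of_all _ fun y q hq => ?_)
    (hG.integrable_mul_exp_quadratic (half_pos hp) 0) (ae_of_all _ fun y q hq => ?_)
  · refine Continuous.aestronglyMeasurable ?_
    have := hg1.cont
    have := hg2.cont
    fun_prop
  · have he : Real.exp (q.2 * y - q.1 * y ^ 2) ≤
        (Real.exp (B * y) + Real.exp (-B * y)) * Real.exp (0 * y - p.1 / 2 * y ^ 2) := by
      rw [sub_eq_add_neg, Real.exp_add]
      refine mul_le_mul ?_ (Real.exp_le_exp.2 ?_) (Real.exp_pos _).le (by positivity)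
      · have h1 := abs_lt.1 hq.2
        rcases le_total 0 y with hy | hy
        · have : Real.exp (q.2 * y) ≤ Real.exp (B * y) := by
            gcongr; exact h1.2.le
          linarith [Real.exp_pos (-B * y)]
        · have : Real.exp (q.2 * y) ≤ Real.exp (-B * y) :=
            Real.exp_le_exp.2 (mul_le_mul_of_nonpos_right h1.1.le hy)
          linarith [Real.exp_pos (B * y)]
      · nlinarith [mul_nonneg (sub_nonneg.2 hq.1.le) (sq_nonneg y)]
    have h1 : ‖D q y‖ ≤ (|y * g y| + |y * (y * g y)|) * Real.exp (q.2 * y - q.1 * y ^ 2) := by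
      refine (norm_sub_le _ _).trans ?_
      rw [norm_smul, norm_smul, norm_mul, norm_mul (y * (y * g y)), Real.norm_eq_abs,
        Real.norm_eq_abs, Real.norm_eq_abs, abs_of_pos (Real.exp_pos _), add_mul]
      refine add_le_add (mul_le_of_le_one_right (by positivity)
        (ContinuousLinearMap.norm_snd_le ℝ ℝ ℝ)) (mul_le_of_le_one_right (by positivity)
        (ContinuousLinearMap.norm_fst_le ℝ ℝ ℝ))
    refine h1.trans ?_
    simp only [G]
    rw [mul_assoc]
    exact mul_le_mul_of_nonneg_left he (by positivity)
  · have h1 : HasFDerivAt (fun q : ℝ × ℝ => q.2 * y - q.1 * y ^ 2)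
        (y • ContinuousLinearMap.snd ℝ ℝ ℝ - y ^ 2 • ContinuousLinearMap.fst ℝ ℝ ℝ) q :=
      (hasFDerivAt_snd.mul_const y).sub (hasFDerivAt_fst.mul_const (y ^ 2))
    refine (h1.exp.const_mul (g y)).congr_fderiv ?_
    ext <;> simp [hD] <;> ring

theorem contDiffOn_quadLaplace_nat (n : ℕ) :
    ∀ {g : ℝ → ℝ}, ContinuousExpGrowth g → ContDiffOn ℝ n (quadLaplace g) {p | 0 < p.1} := by
  have hopen : IsOpen {p : ℝ × ℝ | 0 < p.1} := isOpen_lt continuous_const continuous_fst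
  induction n with
  | zero =>
    intro g hg
    exact contDiffOn_zero.2 fun p hp =>
      (hg.hasFDerivAt_quadLaplace hp).continuousAt.continuousWithinAt
  | succ n ih =>
    intro g hg
    have hg1 : ContinuousExpGrowth fun y => y * g y := ContinuousExpGrowth.id.mul hg
    have hg2 : ContinuousExpGrowth fun y => y * (y * g y) := ContinuousExpGrowth.id.mul hg1
    push_cast
    refine (contDiffOn_succ_iff_fderiv_of_isOpen hopen).2
      ⟨fun p hp => (hg.hasFDerivAt_quadLaplace hp).differentiableAt.differentiableWithinAt,
        fun h => by simp at h, ?_⟩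
    refine (((ih hg1).smul contDiffOn_const).sub ((ih hg2).smul contDiffOn_const)).congr
      fun p hp => (hg.hasFDerivAt_quadLaplace hp).fderiv

theorem contDiffOn_quadLaplace (hg : ContinuousExpGrowth g) :
    ContDiffOn ℝ (⊤ : ℕ∞) (quadLaplace g) {p | 0 < p.1} :=
  contDiffOn_infty.2 fun n => contDiffOn_quadLaplace_nat n hg

theorem gaussAvg_eq_quadLaplace (hg : ContinuousExpGrowth g) (m : ℝ) {s : ℝ} (hs : 0 < s) :
    gaussAvg g m s = (√(2 * Real.pi * s ^ 2))⁻¹ * Real.exp (-m ^ 2 / (2 * s ^ 2)) *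
      quadLaplace g (1 / (2 * s ^ 2), m / s ^ 2) := by
  have hmap : (gaussianReal 0 1).map (fun z => m + s * z) =
      gaussianReal m (NNReal.mk (s ^ 2) (sq_nonneg s)) := by
    have : (fun z => m + s * z) = (fun y => m + y) ∘ fun z => s * z := rfl
    rw [this, ← Measure.map_map (by fun_prop) (by fun_prop), gaussianReal_map_const_mul,
      gaussianReal_map_const_add]
    simp
  have hv : NNReal.mk (s ^ 2) (sq_nonneg s) ≠ 0 := by
    intro h
    have := congrArg NNReal.toReal h
    simp [hs.ne'] at this
  rw [gaussAvg, ← integral_map (φ := fun z => m + s * z) (by fun_prop)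
    hg.cont.aestronglyMeasurable, hmap, integral_gaussianReal_eq_integral_smul hv, quadLaplace,
    ← integral_const_mul]
  refine integral_congr_ae (ae_of_all _ fun y => ?_)
  have : -(y - m) ^ 2 / (2 * s ^ 2) =
      -m ^ 2 / (2 * s ^ 2) + (m / s ^ 2 * y - 1 / (2 * s ^ 2) * y ^ 2) := by
    field_simp; ring
  simp only [gaussianPDFReal, NNReal.coe_mk, smul_eq_mul]
  rw [this, Real.exp_add]
  ring

theorem contDiffOn_gaussAvg (hg : ContinuousExpGrowth g) :
    ContDiffOn ℝ (⊤ : ℕ∞) (fun p : ℝ × ℝ => gaussAvg g p.1 p.2) {p | 0 < p.2} := by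
  have hne : ∀ p ∈ {p : ℝ × ℝ | 0 < p.2}, p.2 ^ 2 ≠ 0 := fun p hp => (pow_pos hp 2).ne'
  have hsq : ContDiffOn ℝ (⊤ : ℕ∞) (fun p : ℝ × ℝ => p.2 ^ 2) {p | 0 < p.2} := by fun_prop
  have hsq2 : ContDiffOn ℝ (⊤ : ℕ∞) (fun p : ℝ × ℝ => 2 * p.2 ^ 2) {p | 0 < p.2} := by fun_prop
  have hne2 : ∀ p ∈ {p : ℝ × ℝ | 0 < p.2}, 2 * p.2 ^ 2 ≠ 0 :=
    fun p hp => mul_ne_zero two_ne_zero (hne p hp)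
  have h3 : ContDiffOn ℝ (⊤ : ℕ∞) (fun p : ℝ × ℝ => 2 * Real.pi * p.2 ^ 2) {p | 0 < p.2} := by
    fun_prop
  have h3ne : ∀ p ∈ {p : ℝ × ℝ | 0 < p.2}, 2 * Real.pi * p.2 ^ 2 ≠ 0 :=
    fun p hp => mul_ne_zero (by positivity) (hne p hp)
  have h1 : ContDiffOn ℝ (⊤ : ℕ∞) (fun p : ℝ × ℝ => -p.1 ^ 2) {p | 0 < p.2} := by fun_prop
  have hK := hg.contDiffOn_quadLaplace.comp (s := {p : ℝ × ℝ | 0 < p.2})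
    (f := fun p : ℝ × ℝ => (1 / (2 * p.2 ^ 2), p.1 / p.2 ^ 2))
    ((contDiffOn_const.div hsq2 hne2).prodMk (contDiffOn_fst.div hsq hne))
    (fun p hp => by
      have : 0 < p.2 := hp
      simp only [mem_ofPred_eq]; positivity)
  refine ((((h3.sqrt h3ne).inv ?_).mul (h1.div hsq2 hne2).exp).mul hK).congr fun p hp =>
    hg.gaussAvg_eq_quadLaplace p.1 hp
  intro p hp
  have : 0 < p.2 := hp
  positivity

theorem integral_gaussian_mul (hg : ContinuousExpGrowth g) (m : ℝ) {s : ℝ} (hs : s ≠ 0) :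
    ∫ z, g (m + s * z) * z ∂gaussianReal 0 1 =
      s⁻¹ * (gaussAvg (fun y => y * g y) m s - m * gaussAvg g m s) := by
  have hg1 : ContinuousExpGrowth fun y => y * g y := ContinuousExpGrowth.id.mul hg
  rw [gaussAvg, gaussAvg, ← integral_const_mul, ← integral_sub
    ((hg1.comp_affine m s).integrable_gaussian _ _)
    (((hg.comp_affine m s).integrable_gaussian _ _).const_mul m), ← integral_const_mul]
  refine integral_congr_ae (ae_of_all _ fun z => ?_)
  field_simp
  ring

theorem hasDerivAt_gaussAvg_mean (hg : ContinuousExpGrowth g) (m : ℝ) {s : ℝ} (hs : 0 < s) :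
    HasDerivAt (fun x => gaussAvg g x s) (s⁻¹ * ∫ z, g (m + s * z) * z ∂gaussianReal 0 1) m := by
  have hg1 : ContinuousExpGrowth fun y => y * g y := ContinuousExpGrowth.id.mul hg
  have hp : 0 < 1 / (2 * s ^ 2) := by positivity
  have hK : HasDerivAt (fun x => quadLaplace g (1 / (2 * s ^ 2), x / s ^ 2))
      (quadLaplace (fun y => y * g y) (1 / (2 * s ^ 2), m / s ^ 2) * (1 / s ^ 2)) m := by
    have hc : HasDerivAt (fun x : ℝ => (1 / (2 * s ^ 2), x / s ^ 2)) (0, 1 / s ^ 2) m :=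
      (hasDerivAt_const m _).prodMk ((hasDerivAt_id m).div_const _)
    have := (hg.hasFDerivAt_quadLaplace (p := (1 / (2 * s ^ 2), m / s ^ 2)) hp).comp_hasDerivAt m hc
    refine this.congr_deriv ?_
    simp
  have hE : HasDerivAt (fun x : ℝ => Real.exp (-x ^ 2 / (2 * s ^ 2)))
      (Real.exp (-m ^ 2 / (2 * s ^ 2)) * (-(2 * m) / (2 * s ^ 2))) m := by
    have := ((hasDerivAt_pow 2 m).neg.div_const (2 * s ^ 2)).exp
    simpa using this
  have h := (hE.const_mul (√(2 * Real.pi * s ^ 2))⁻¹).mul hK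
  have heq : (fun x => gaussAvg g x s) = fun x => (√(2 * Real.pi * s ^ 2))⁻¹ *
      Real.exp (-x ^ 2 / (2 * s ^ 2)) * quadLaplace g (1 / (2 * s ^ 2), x / s ^ 2) :=
    funext fun x => hg.gaussAvg_eq_quadLaplace x hs
  rw [heq]
  refine h.congr_deriv ?_
  rw [hg.integral_gaussian_mul m hs.ne', hg.gaussAvg_eq_quadLaplace m hs,
    hg1.gaussAvg_eq_quadLaplace m hs]
  field_simp
  ring

theorem continuous_gaussAvg (hg : ContinuousExpGrowth g) :
    Continuous fun p : ℝ × ℝ => gaussAvg g p.1 p.2 := by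
  refine continuous_iff_continuousAt.2 fun p => ?_
  obtain ⟨b, hb, hgb⟩ := hg.affine_bound (|p.1| + |p.2| + 1)
  refine continuousAt_of_dominated (Eventually.of_forall fun q =>
    ((hg.comp_affine q.1 q.2).cont).aestronglyMeasurable) ?_ (hb.integrable_gaussian _ _)
    (ae_of_all _ fun z => (hg.cont.comp (by fun_prop)).continuousAt)
  have h1 : ∀ᶠ q : ℝ × ℝ in 𝓝 p, |q.1| < |p.1| + |p.2| + 1 :=
    (continuous_fst.abs).continuousAt.eventually_lt continuousAt_const
      (by have := abs_nonneg p.2; linarith)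
  have h2 : ∀ᶠ q : ℝ × ℝ in 𝓝 p, |q.2| < |p.1| + |p.2| + 1 :=
    (continuous_snd.abs).continuousAt.eventually_lt continuousAt_const
      (by have := abs_nonneg p.1; linarith)
  filter_upwards [h1, h2] with q hq1 hq2
  exact ae_of_all _ fun z => hgb _ _ z hq1.le hq2.le

theorem hasDerivAt_gaussAvg_curve (hg : ContinuousExpGrowth g) {g' : ℝ → ℝ}
    (hg' : ContinuousExpGrowth g') (hd : ∀ y, HasDerivAt g (g' y) y) {m s m' s' : ℝ → ℝ}
    {θ₀ M : ℝ} {S : Set ℝ} (hS : S ∈ 𝓝 θ₀)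
    (hm : ∀ θ ∈ S, HasDerivAt m (m' θ) θ) (hs : ∀ θ ∈ S, HasDerivAt s (s' θ) θ)
    (hM : ∀ θ ∈ S, |m θ| ≤ M ∧ |s θ| ≤ M ∧ |m' θ| ≤ M ∧ |s' θ| ≤ M) :
    HasDerivAt (fun θ => gaussAvg g (m θ) (s θ))
      (m' θ₀ * gaussAvg g' (m θ₀) (s θ₀) +
        s' θ₀ * ∫ z, g' (m θ₀ + s θ₀ * z) * z ∂gaussianReal 0 1) θ₀ := by
  obtain ⟨b, hb, hgb⟩ := hg'.affine_bound M
  have hz : ContinuousExpGrowth fun z : ℝ => M + M * |z| :=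
    ⟨by fun_prop, |M|, 1, zero_le_one, fun z => by
      have : M + M * |z| = M * (1 + |z|) := by ring
      rw [this, abs_mul, abs_of_nonneg (by positivity : 0 ≤ 1 + |z|)]
      refine mul_le_mul_of_nonneg_left ?_ (abs_nonneg M)
      linarith [Real.add_one_le_exp (1 * |z|)]⟩
  have hc := hg'.comp_affine (m θ₀) (s θ₀)
  have key := hasDerivAt_integral_of_dominated_loc_of_deriv_le (μ := gaussianReal 0 1)
    (F := fun θ z => g (m θ + s θ * z))
    (F' := fun θ z => g' (m θ + s θ * z) * (m' θ + s' θ * z))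
    (bound := fun z => b z * (M + M * |z|)) hS
    (Eventually.of_forall fun θ => (hg.comp_affine (m θ) (s θ)).cont.aestronglyMeasurable)
    ((hg.comp_affine _ _).integrable_gaussian _ _)
    (hc.cont.mul (by fun_prop)).aestronglyMeasurable
    (ae_of_all _ fun z θ hθ => ?_) ((hb.mul hz).integrable_gaussian _ _)
    (ae_of_all _ fun z θ hθ => ?_)
  · refine key.2.congr_deriv ?_
    rw [gaussAvg, ← integral_const_mul, ← integral_const_mul, ← integral_add
      ((hc.integrable_gaussian _ _).const_mul _)
      (((hc.mul ContinuousExpGrowth.id).integrable_gaussian _ _).const_mul _)]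
    refine integral_congr_ae (ae_of_all _ fun z => ?_)
    ring
  · obtain ⟨h1, h2, h3, h4⟩ := hM θ hθ
    rw [norm_mul, Real.norm_eq_abs, Real.norm_eq_abs]
    have h5 := hgb _ _ z h1 h2
    refine mul_le_mul h5 ((abs_add_le _ _).trans ?_) (abs_nonneg _) ((abs_nonneg _).trans h5)
    rw [abs_mul]
    gcongr
  · exact (hd _).comp θ ((hm θ hθ).add ((hs θ hθ).mul_const z))

/-- If `g` is bounded on `[0, ∞)`, then `g (x + m + s * z)` is dominated uniformly in `x ≥ 0`. -/
theorem nonneg_shift_bound (hg : ContinuousExpGrowth g) {B : ℝ}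
    (hB : ∀ y, 0 ≤ y → |g y| ≤ B) (M : ℝ) :
    ∃ b : ℝ → ℝ, ContinuousExpGrowth b ∧
      ∀ x m s z, 0 ≤ x → |m| ≤ M → |s| ≤ M → |g (x + m + s * z)| ≤ b z := by
  obtain ⟨C, A, hC0, hA, hC⟩ := hg.le_exp_max hB
  rcases lt_or_ge M 0 with hM | hM
  · exact ⟨fun _ => 0, const 0, fun x m s z _ hm _ =>
      absurd ((abs_nonneg m).trans hm) (not_le.2 hM)⟩
  refine ⟨fun z => C * Real.exp (A * (M + M * |z|)), ⟨by fun_prop, C * Real.exp (A * M), A * M,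
    by positivity, fun z => ?_⟩, fun x m s z hx hm hs => (hC _).trans ?_⟩
  · rw [abs_of_nonneg (by positivity), mul_assoc, ← Real.exp_add]
    apply le_of_eq; ring_nf
  · have h1 : |s * z| ≤ M * |z| := by
      rw [abs_mul]; gcongr
    have : max (-(x + m + s * z)) 0 ≤ M + M * |z| :=
      max_le (by linarith [neg_abs_le m, neg_abs_le (s * z)]) (by positivity)
    beta_reduce
    gcongr

theorem exists_gaussAvg_bound (hg : ContinuousExpGrowth g) {B : ℝ}
    (hB : ∀ y, 0 ≤ y → |g y| ≤ B) (M : ℝ) :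
    ∃ C, ∀ x m s, 0 ≤ x → |m| ≤ M → |s| ≤ M → |gaussAvg g (x + m) s| ≤ C := by
  obtain ⟨b, hb, h⟩ := hg.nonneg_shift_bound hB M
  refine ⟨∫ z, b z ∂gaussianReal 0 1, fun x m s hx hm hs => ?_⟩
  rw [← Real.norm_eq_abs]
  exact norm_integral_le_of_norm_le (hb.integrable_gaussian 0 1)
    (ae_of_all _ fun z => h x m s z hx hm hs)

theorem tendsto_gaussAvg_zero (hg : ContinuousExpGrowth g) {B : ℝ}
    (hB : ∀ y, 0 ≤ y → |g y| ≤ B) (h0 : Tendsto g atTop (𝓝 0)) (m s : ℝ) :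
    Tendsto (fun x => gaussAvg g (x + m) s) atTop (𝓝 0) := by
  obtain ⟨b, hb, h⟩ := hg.nonneg_shift_bound hB (max |m| |s|)
  have := tendsto_integral_filter_of_dominated_convergence (μ := gaussianReal 0 1)
    (F := fun x z => g (x + m + s * z)) (f := fun _ => 0) (l := atTop) b
    (Eventually.of_forall fun x => (hg.comp_affine (x + m) s).cont.aestronglyMeasurable)
    ((eventually_ge_atTop 0).mono fun x hx => ae_of_all _ fun z =>
      h x m s z hx (le_max_left _ _) (le_max_right _ _)) (hb.integrable_gaussian _ _)
    (ae_of_all _ fun z => h0.comp (tendsto_atTop_add_const_right _ _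
      (tendsto_atTop_add_const_right _ _ tendsto_id)))
  simpa [gaussAvg] using this

end ContinuousExpGrowth

/-- The extension of `p` from `[0, ∞)` to `ℝ` by the reflection law that turns the drifted heat
flow into a Neumann problem at `0`. -/
noncomputable def neumannExtension (μ : ℝ) (p : ℝ → ℝ) (y : ℝ) : ℝ :=
  if 0 ≤ y then p y
  else Real.exp (2 * μ * -y) * p (-y) -
    2 * μ * ∫ r in (0 : ℝ)..(-y), Real.exp (2 * μ * r) * p r

namespace ContinuousExpGrowth

variable {p : ℝ → ℝ}

theorem neumannExtension (hp : ContinuousExpGrowth p) (μ : ℝ) :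
    ContinuousExpGrowth (neumannExtension μ p) := by
  have hE : ContinuousExpGrowth fun r => Real.exp (2 * μ * r) * p r := (exp_mul (2 * μ)).mul hp
  have hq := (hE.add ((const (-(2 * μ))).mul hE.primitive)).comp_neg
  have := hp.ite_le hq (by simp)
  convert this using 1
  funext y
  simp only [_root_.neumannExtension]
  congr 1
  ring

theorem integral_neumannExtension_mul (hp : ContinuousExpGrowth p) (μ : ℝ) {s : ℝ}
    (hs : 0 < s) :
    ∫ z, _root_.neumannExtension μ p (μ * s ^ 2 + s * z) * z ∂gaussianReal 0 1 = 0 := by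
  have hW := hp.neumannExtension μ
  have hE : ContinuousExpGrowth fun r => Real.exp (2 * μ * r) * p r := (exp_mul (2 * μ)).mul hp
  have hI := hE.primitive
  set W := _root_.neumannExtension μ p with hWdef
  set a : ℝ := 1 / (2 * s ^ 2) with ha
  have ha0 : 0 < a := by positivity
  set m : ℝ := μ * s ^ 2 with hm
  have ham : 2 * a * m = μ := by rw [ha, hm]; field_simp
  have hW1 : ContinuousExpGrowth fun y => y * W y := ContinuousExpGrowth.id.mul hW
  have hmb : m / s ^ 2 = μ := by rw [hm]; field_simp
  have hJint : Integrable fun y => (y - m) * W y * Real.exp (μ * y - a * y ^ 2) := by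
    have := ((ContinuousExpGrowth.id.add (const (-m))).mul hW).integrable_mul_exp_quadratic ha0 μ
    simpa only [sub_eq_add_neg] using this
  set I : ℝ → ℝ := fun y => ∫ r in (0 : ℝ)..y, Real.exp (2 * μ * r) * p r with hIdef
  suffices h : ∫ y, (y - m) * W y * Real.exp (μ * y - a * y ^ 2) = 0 by
    rw [hW.integral_gaussian_mul m hs.ne', hW.gaussAvg_eq_quadLaplace m hs,
      hW1.gaussAvg_eq_quadLaplace m hs, mul_left_comm m, ← mul_sub]
    have : quadLaplace (fun y => y * W y) (a, μ) - m * quadLaplace W (a, μ) = 0 := by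
      rw [quadLaplace, quadLaplace, ← integral_const_mul, ← integral_sub
        (hW1.integrable_mul_exp_quadratic ha0 μ)
        ((hW.integrable_mul_exp_quadratic ha0 μ).const_mul m), ← h]
      refine integral_congr_ae (ae_of_all _ fun y => ?_)
      ring
    rw [hmb, this, mul_zero, mul_zero]
  set R : ℝ → ℝ := fun y => -2 * m * I y * Real.exp (-μ * y - a * y ^ 2) with hR
  have hRint : Integrable R :=
    ((const (-2 * m)).mul hI).integrable_mul_exp_quadratic ha0 (-μ)
  have hRd : ∀ y ∈ Ioi (0 : ℝ), HasDerivAt R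
      ((-y - m) * W (-y) * Real.exp (μ * -y - a * (-y) ^ 2) +
        (y - m) * W y * Real.exp (μ * y - a * y ^ 2)) y := by
    intro y hy
    have hy0 : 0 < y := hy
    have h1 : HasDerivAt I (Real.exp (2 * μ * y) * p y) y :=
      intervalIntegral.integral_hasDerivAt_right (hE.cont.intervalIntegrable _ _)
        (hE.cont.stronglyMeasurableAtFilter _ _) hE.cont.continuousAt
    have h2 : HasDerivAt (fun y => Real.exp (-μ * y - a * y ^ 2))
        (Real.exp (-μ * y - a * y ^ 2) * (-μ - a * (2 * y))) y := by
      have := (((hasDerivAt_id y).const_mul (-μ)).sub ((hasDerivAt_pow 2 y).const_mul a)).exp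
      simpa using this
    refine ((h1.const_mul (-2 * m)).mul h2).congr_deriv ?_
    have hWp : W y = p y := if_pos hy0.le
    have hWn : W (-y) = Real.exp (2 * μ * y) * p y - 2 * μ * I y := by
      rw [hWdef, _root_.neumannExtension, if_neg (by linarith), neg_neg]
    have he1 : Real.exp (μ * y - a * y ^ 2) =
        Real.exp (2 * μ * y) * Real.exp (-μ * y - a * y ^ 2) := by
      rw [← Real.exp_add]; ring_nf
    have he2 : Real.exp (μ * -y - a * (-y) ^ 2) = Real.exp (-μ * y - a * y ^ 2) := by ring_nf
    rw [hWp, hWn, he1, he2]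
    linear_combination (2 * I y * Real.exp (-μ * y - a * y ^ 2) * y) * ham
  have hint : IntegrableOn (fun y => (-y - m) * W (-y) * Real.exp (μ * -y - a * (-y) ^ 2) +
      (y - m) * W y * Real.exp (μ * y - a * y ^ 2)) (Ioi 0) :=
    (hJint.comp_neg.add hJint).integrableOn
  have hlim : Tendsto R atTop (𝓝 0) :=
    tendsto_zero_of_hasDerivAt_of_integrableOn_Ioi hRd hint hRint.integrableOn
  have hcont : Continuous R := by
    have := hI.cont
    simp only [hR]
    fun_prop
  have key := integral_Ioi_of_hasDerivAt_of_tendsto hcont.continuousWithinAt hRd hint hlim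
  rw [integral_add hJint.comp_neg.integrableOn hJint.integrableOn,
    integral_comp_neg_Ioi 0 fun y => (y - m) * W y * Real.exp (μ * y - a * y ^ 2), neg_zero,
    intervalIntegral.integral_Iic_add_Ioi hJint.integrableOn hJint.integrableOn] at key
  rw [key]
  simp [hR, hIdef]

end ContinuousExpGrowth

/-- The solution on `ℝ` of `F' + κ F = W` with `F 0 = c`. -/
noncomputable def linearODESol (κ c : ℝ) (W : ℝ → ℝ) (y : ℝ) : ℝ :=
  Real.exp (-κ * y) * (c + ∫ r in (0 : ℝ)..y, Real.exp (κ * r) * W r)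

namespace ContinuousExpGrowth

variable {W : ℝ → ℝ}

theorem linearODESol (hW : ContinuousExpGrowth W) (κ c : ℝ) :
    ContinuousExpGrowth (linearODESol κ c W) :=
  (exp_mul (-κ)).mul ((const c).add ((exp_mul κ).mul hW).primitive)

theorem hasDerivAt_linearODESol (hW : ContinuousExpGrowth W) (κ c y : ℝ) :
    HasDerivAt (_root_.linearODESol κ c W) (W y + -κ * _root_.linearODESol κ c W y) y := by
  have hE := ((exp_mul κ).mul hW).cont
  have h1 : HasDerivAt (fun y => ∫ r in (0 : ℝ)..y, Real.exp (κ * r) * W r)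
      (Real.exp (κ * y) * W y) y :=
    intervalIntegral.integral_hasDerivAt_right (hE.intervalIntegrable _ _)
      (hE.stronglyMeasurableAtFilter _ _) hE.continuousAt
  have h2 : HasDerivAt (fun y => Real.exp (-κ * y)) (Real.exp (-κ * y) * -κ) y := by
    simpa using ((hasDerivAt_id y).const_mul (-κ)).exp
  refine (h2.mul (h1.const_add c)).congr_deriv ?_
  have : Real.exp (-κ * y) * Real.exp (κ * y) = 1 := by
    rw [← Real.exp_add]; simp
  rw [_root_.linearODESol]
  linear_combination W y * this

end ContinuousExpGrowth

theorem linearODESol_eq_of_hasDerivAt {κ : ℝ} {f f' W : ℝ → ℝ} (hf : ContinuousOn f (Ici 0))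
    (hW : Continuous W) (hd : ∀ y, 0 < y → HasDerivAt f (f' y) y)
    (hfW : ∀ y, 0 < y → f' y + κ * f y = W y) {y : ℝ} (hy : 0 ≤ y) :
    linearODESol κ (f 0) W y = f y := by
  have h : ∫ r in (0 : ℝ)..y, Real.exp (κ * r) * W r =
      Real.exp (κ * y) * f y - Real.exp (κ * 0) * f 0 := by
    refine intervalIntegral.integral_eq_sub_of_hasDeriv_right
      (f := fun r => Real.exp (κ * r) * f r) ?_ ?_ ?_
    · rw [uIcc_of_le hy]
      exact ContinuousOn.mul (by fun_prop) (hf.mono Icc_subset_Ici_self)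
    · intro x hx
      rw [min_eq_left hy] at hx
      have h2 : HasDerivAt (fun r => Real.exp (κ * r)) (Real.exp (κ * x) * κ) x := by
        simpa using ((hasDerivAt_id x).const_mul κ).exp
      refine ((h2.mul (hd x hx.1)).congr_deriv ?_).hasDerivWithinAt
      rw [← hfW x hx.1]
      ring
    · exact Continuous.intervalIntegrable (by fun_prop) _ _
  have h1 : Real.exp (-κ * y) * Real.exp (κ * y) = 1 := by
    rw [← Real.exp_add]; simp
  rw [linearODESol, h, mul_zero, Real.exp_zero]
  linear_combination f y * h1

/-- The drifted Gaussian flow of suitable data on the whole line solves the problem: it suffices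
that the Robin combination `F' + κ F` of the data has vanishing weighted first moments. -/
theorem isSWSolution_gaussAvg {μ ν B B' : ℝ} {f F F' : ℝ → ℝ} (hF : ContinuousExpGrowth F)
    (hF' : ContinuousExpGrowth F') (hd : ∀ y, HasDerivAt F (F' y) y)
    (hB : ∀ y, 0 ≤ y → |F y| ≤ B) (hB' : ∀ y, 0 ≤ y → |F' y| ≤ B')
    (h0 : Tendsto F atTop (𝓝 0)) (hfF : ∀ y, 0 ≤ y → F y = f y)
    (hbdry : ∀ s, 0 < s → ∫ z, (F' (μ * s ^ 2 + s * z) +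
      2 * (μ - ν) * F (μ * s ^ 2 + s * z)) * z ∂gaussianReal 0 1 = 0) :
    IsSWSolution μ ν f fun t x => gaussAvg F (x + μ * t) (√t) := by
  set u : ℝ → ℝ → ℝ := fun t x => gaussAvg F (x + μ * t) (√t) with hu
  have hdx : ∀ t x, HasDerivAt (fun z => u t z) (gaussAvg F' (x + μ * t) (√t)) x := by
    intro t x
    have hM : ∀ θ ∈ Icc (x - 1) (x + 1), |θ + μ * t| ≤ |x| + |μ * t| + |√t| + 1 ∧
        |√t| ≤ |x| + |μ * t| + |√t| + 1 ∧ |(1 : ℝ)| ≤ |x| + |μ * t| + |√t| + 1 ∧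
        |(0 : ℝ)| ≤ |x| + |μ * t| + |√t| + 1 := by
      intro θ hθ
      have h1 := abs_nonneg x
      have h2 := abs_nonneg (μ * t)
      have h3 := abs_nonneg √t
      have h4 : |θ| ≤ |x| + 1 :=
        abs_le.2 ⟨by linarith [hθ.1, neg_abs_le x], by linarith [hθ.2, le_abs_self x]⟩
      refine ⟨by linarith [abs_add_le θ (μ * t)], by linarith, ?_, ?_⟩
      · rw [abs_one]; linarith
      · rw [abs_zero]; linarith
    have := hF.hasDerivAt_gaussAvg_curve hF' hd (θ₀ := x)
      (Icc_mem_nhds (by linarith) (by linarith))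
      (fun θ _ => (hasDerivAt_id θ).add_const (μ * t)) (fun θ _ => hasDerivAt_const θ √t) hM
    simpa using this
  have hdt : ∀ t x, 0 < t → HasDerivAt (fun τ => u τ x) (μ * gaussAvg F' (x + μ * t) (√t) +
      1 / (2 * √t) * ∫ z, F' (x + μ * t + √t * z) * z ∂gaussianReal 0 1) t := by
    intro t x ht
    set M := |x| + |μ| * (2 * t) + √(2 * t) + |μ| + 1 / (2 * √(t / 2)) with hMdef
    refine hF.hasDerivAt_gaussAvg_curve hF' hd (θ₀ := t) (m := fun τ => x + μ * τ) (s := Real.sqrt)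
      (m' := fun _ => μ) (s' := fun τ => 1 / (2 * √τ)) (M := M)
      (Icc_mem_nhds (by linarith : t / 2 < t) (by linarith : t < 2 * t))
      (fun θ _ => ?_) (fun θ hθ => ?_) (fun θ hθ => ?_)
    · simpa using ((hasDerivAt_id θ).const_mul μ).const_add x
    · exact Real.hasDerivAt_sqrt (by linarith [hθ.1])
    · have hθ0 : 0 < θ := by linarith [hθ.1]
      have p1 := abs_nonneg x
      have p2 := abs_nonneg μ
      have p3 : 0 ≤ |μ| * (2 * t) := by positivity
      have p4 := Real.sqrt_nonneg (2 * t)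
      have p5 : 0 ≤ 1 / (2 * √(t / 2)) := by positivity
      have q1 : |μ * θ| ≤ |μ| * (2 * t) := by
        rw [abs_mul, abs_of_pos hθ0]; gcongr; exact hθ.2
      have q2 : √θ ≤ √(2 * t) := Real.sqrt_le_sqrt hθ.2
      have q3 : 1 / (2 * √θ) ≤ 1 / (2 * √(t / 2)) := by
        have := Real.sqrt_le_sqrt hθ.1
        gcongr
      refine ⟨by linarith [abs_add_le x (μ * θ)], ?_, by linarith, ?_⟩
      · rw [abs_of_nonneg (Real.sqrt_nonneg θ)]; linarith
      · rw [abs_of_nonneg (by positivity)]; linarith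
  have hux : ∀ t x, 0 ≤ x → ux u t x = gaussAvg F' (x + μ * t) (√t) := fun t x hx =>
    (hdx t x).hasDerivWithinAt.derivWithin (uniqueDiffOn_Ici 0 x hx)
  have hshift : ∀ {g : ℝ → ℝ}, ContinuousExpGrowth g → ∀ t x, 0 < t →
      HasDerivAt (fun z => gaussAvg g (z + μ * t) (√t))
        ((√t)⁻¹ * ∫ z, g (x + μ * t + √t * z) * z ∂gaussianReal 0 1) x := fun hg t x ht =>
    (hg.hasDerivAt_gaussAvg_mean (x + μ * t) (Real.sqrt_pos.2 ht)).comp_add_const x (μ * t)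
  have huxx : ∀ t x, 0 < t → 0 ≤ x →
      uxx u t x = (√t)⁻¹ * ∫ z, F' (x + μ * t + √t * z) * z ∂gaussianReal 0 1 := by
    intro t x ht hx
    rw [uxx, derivWithin_congr (s := Ici 0) (fun z (hz : 0 ≤ z) => hux t z hz) (hux t x hx)]
    exact (hshift hF' t x ht).hasDerivWithinAt.derivWithin (uniqueDiffOn_Ici 0 x hx)
  have hut : ∀ t x, 0 < t → 0 ≤ x → ut u t x = μ * ux u t x + 1 / 2 * uxx u t x := by
    intro t x ht hx
    rw [ut, (hdt t x ht).deriv, hux t x hx, huxx t x ht hx]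
    ring
  have hbd : ∀ {g : ℝ → ℝ} {D : ℝ}, ContinuousExpGrowth g → (∀ y, 0 ≤ y → |g y| ≤ D) →
      ∀ T > (0 : ℝ), ∃ C, ∀ q ∈ Icc (0 : ℝ) T ×ˢ Ici (0 : ℝ),
        |gaussAvg g (q.2 + μ * q.1) (√q.1)| ≤ C := by
    intro g D hg hD T hT
    obtain ⟨C, hC⟩ := hg.exists_gaussAvg_bound hD (max (|μ| * T) (√T))
    refine ⟨C, fun q hq => hC _ _ _ hq.2 (le_max_of_le_left ?_) (le_max_of_le_right ?_)⟩
    · rw [abs_mul, abs_of_nonneg hq.1.1]; gcongr; exact hq.1.2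
    · rw [abs_of_nonneg (Real.sqrt_nonneg _)]; exact Real.sqrt_le_sqrt hq.1.2
  have hcont : ∀ {g : ℝ → ℝ}, ContinuousExpGrowth g →
      Continuous fun q : ℝ × ℝ => gaussAvg g (q.2 + μ * q.1) (√q.1) := fun hg =>
    hg.continuous_gaussAvg.comp (f := fun q : ℝ × ℝ => (q.2 + μ * q.1, √q.1)) (by fun_prop)
  refine ⟨?_, fun T hT => ⟨(hcont hF).continuousOn, ?_, ?_⟩, fun t _ =>
    hF.tendsto_gaussAvg_zero hB h0 (μ * t) √t, fun t ht x hx => hut t x ht hx, fun x hx => ?_,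
    fun t ht => ?_⟩
  · refine hF.contDiffOn_gaussAvg.comp (f := fun q : ℝ × ℝ => (q.2 + μ * q.1, √q.1)) ?_
      fun q hq => Real.sqrt_pos.2 hq.1
    refine ContDiffOn.prodMk (by fun_prop) (contDiffOn_fst.sqrt fun q hq => ne_of_gt hq.1)
  · exact (hcont hF').continuousOn.congr fun q hq => hux q.1 q.2 hq.2
  · obtain ⟨C, hC⟩ := hbd hF hB T hT
    obtain ⟨C', hC'⟩ := hbd hF' hB' T hT
    refine ⟨max C C', fun q hq => ⟨(hC q hq).trans (le_max_left _ _), ?_⟩⟩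
    rw [hux q.1 q.2 hq.2]
    exact (hC' q hq).trans (le_max_right _ _)
  · simp [hu, gaussAvg, hfF x hx]
  · have hs := Real.sqrt_pos.2 ht
    have h1 := hbdry _ hs
    rw [Real.sq_sqrt ht.le] at h1
    have hA : gaussAvg F' (0 + μ * t) (√t) =
        (√t)⁻¹ * ∫ z, F (0 + μ * t + √t * z) * z ∂gaussianReal 0 1 :=
      (hdx t 0).unique (hshift hF t 0 ht)
    have hsplit : ∫ z, (F' (μ * t + √t * z) + 2 * (μ - ν) * F (μ * t + √t * z)) * z
          ∂gaussianReal 0 1 = ∫ z, F' (μ * t + √t * z) * z ∂gaussianReal 0 1 +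
        2 * (μ - ν) * ∫ z, F (μ * t + √t * z) * z ∂gaussianReal 0 1 := by
      rw [← integral_const_mul, ← integral_add
        (((hF'.comp_affine _ _).mul ContinuousExpGrowth.id).integrable_gaussian _ _)
        ((((hF.comp_affine _ _).mul ContinuousExpGrowth.id).integrable_gaussian _ _).const_mul _)]
      refine integral_congr_ae (ae_of_all _ fun z => ?_)
      ring
    rw [hsplit] at h1
    rw [hut t 0 ht le_rfl, hux t 0 le_rfl, huxx t 0 ht le_rfl]
    simp only [zero_add] at hA ⊢
    linear_combination (μ - ν) * hA + (√t)⁻¹ / 2 * h1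

/-- existence of a solution to the Stroock–Williams problem. -/
theorem stroock_williams_existence (μ ν : ℝ) (f : ℝ → ℝ) (hf : IsInitialData f) :
    ∃ u : ℝ → ℝ → ℝ, IsSWSolution μ ν f u := by
  obtain ⟨hC1, ⟨C, hC⟩, hlim⟩ := hf
  set κ := 2 * (μ - ν) with hκ
  set f' : ℝ → ℝ := derivWithin f (Ici 0) with hf'
  have hmax : ∀ y : ℝ, max y 0 ∈ Ici (0 : ℝ) := fun y => le_max_right y 0
  have hext : ∀ {g : ℝ → ℝ}, ContinuousOn g (Ici 0) → Continuous fun y => g (max y 0) :=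
    fun hg => hg.comp_continuous (by fun_prop) hmax
  have hf'c : ContinuousOn f' (Ici 0) :=
    hC1.continuousOn_derivWithin (uniqueDiffOn_Ici 0) le_rfl
  set p : ℝ → ℝ := fun y => f' (max y 0) + κ * f (max y 0) with hp
  have hpg : ContinuousExpGrowth p :=
    (ContinuousExpGrowth.of_bounded (hext hf'c) fun y => (hC _ (hmax y)).2).add
      ((ContinuousExpGrowth.const κ).mul
        (ContinuousExpGrowth.of_bounded (hext hC1.continuousOn) fun y => (hC _ (hmax y)).1))
  have hW := hpg.neumannExtension μ
  set W := neumannExtension μ p with hWdef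
  have hWp : ∀ y, 0 ≤ y → W y = f' y + κ * f y := fun y hy => by
    rw [hWdef, neumannExtension, if_pos hy, hp]
    simp only [max_eq_left hy]
  have hd : ∀ y, 0 < y → HasDerivAt f (f' y) y := fun y hy =>
    ((hC1.differentiableOn one_ne_zero y hy.le).hasDerivWithinAt).hasDerivAt (Ici_mem_nhds hy)
  have hF := hW.linearODESol κ (f 0)
  have hFd := hW.hasDerivAt_linearODESol κ (f 0)
  have hFf : ∀ y, 0 ≤ y → linearODESol κ (f 0) W y = f y := fun y hy =>
    linearODESol_eq_of_hasDerivAt hC1.continuousOn hW.cont hd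
      (fun y hy => (hWp y hy.le).symm) hy
  refine ⟨_, isSWSolution_gaussAvg (B := C) (B' := C) hF
    (hW.add ((ContinuousExpGrowth.const (-κ)).mul hF)) hFd ?_ ?_ ?_ hFf fun s hs => ?_⟩
  · intro y hy
    rw [hFf y hy]
    exact (hC y hy).1
  · intro y hy
    rw [hFf y hy, hWp y hy]
    simpa using (hC y hy).2
  · exact hlim.congr' ((eventually_ge_atTop 0).mono fun y hy => (hFf y hy).symm)
  · refine Eq.trans ?_ (hpg.integral_neumannExtension_mul μ hs)
    refine integral_congr_ae (ae_of_all _ fun z => ?_)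
    ring
end

section
/- Let μ, ν ∈ ℝ and let f : [0,∞) → ℝ be continuously differentiable with f and f' bounded and f(x) → 0 as x → ∞. Define u(0,x) = f(x) for x ≥ 0 and u(t,x) = ∫₀^∞ f(y) G(t;x,y) dy − ∫₀^∞ f'(y) H(t;x,y) dy for t > 0 and x ≥ 0. Then u is a solution of the Stroock–Williams problem with parameters μ, ν and initial data f. -/
open MeasureTheory Set Filter

/-! ### Gaussian integrals -/

theorem integrable_abs_pow_mul_exp (n : ℕ) (b : ℝ) {c : ℝ} (hc : 0 < c) :
    Integrable fun x : ℝ => |x| ^ n * Real.exp (b * |x| - c * x ^ 2) := by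
  have key : ∀ x : ℝ, ‖|x| ^ n * Real.exp (b * |x| - c * x ^ 2)‖ ≤
      (n.factorial * Real.exp ((b + 1) ^ 2 / (2 * c))) * Real.exp (-(c / 2) * x ^ 2) := by
    intro x
    rw [Real.norm_of_nonneg (by positivity), mul_assoc, ← Real.exp_add]
    have h1 : |x| ^ n ≤ n.factorial * Real.exp |x| := by
      have := Real.pow_div_factorial_le_exp |x| (abs_nonneg x) n
      rwa [div_le_iff₀' (by positivity)] at this
    have h2 : |x| + (b * |x| - c * x ^ 2) ≤ (b + 1) ^ 2 / (2 * c) + -(c / 2) * x ^ 2 := by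
      have h3 : (b + 1) ^ 2 / (2 * c) + -(c / 2) * x ^ 2 - (|x| + (b * |x| - c * x ^ 2)) =
          (b + 1 - c * |x|) ^ 2 / (2 * c) := by
        rw [← sq_abs x]; field_simp; ring
      have : 0 ≤ (b + 1 - c * |x|) ^ 2 / (2 * c) := by positivity
      linarith
    calc _ ≤ n.factorial * Real.exp |x| * Real.exp (b * |x| - c * x ^ 2) := by gcongr
      _ = n.factorial * Real.exp (|x| + (b * |x| - c * x ^ 2)) := by rw [Real.exp_add]; ring
      _ ≤ _ := by gcongr
  refine ((integrable_exp_neg_mul_sq (half_pos hc)).const_mul _).mono' ?_ (ae_of_all _ key)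
  exact Continuous.aestronglyMeasurable (by fun_prop)

theorem phi_nonneg (x : ℝ) : 0 ≤ phi x := by unfold phi; positivity

@[fun_prop]
theorem continuous_phi : Continuous phi := by unfold phi; fun_prop

theorem integrable_exp_mul_abs_mul_phi (b : ℝ) :
    Integrable fun ξ : ℝ => Real.exp (b * |ξ|) * phi ξ := by
  refine ((integrable_abs_pow_mul_exp 0 b (one_half_pos (α := ℝ))).const_mul
    (1 / Real.sqrt (2 * Real.pi))).congr (ae_of_all _ fun ξ => ?_)
  simp only [phi, pow_zero, one_mul, Real.exp_sub, neg_div, Real.exp_neg]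
  rw [show ξ ^ 2 / 2 = 1 / 2 * ξ ^ 2 by ring]
  ring

theorem integrable_phi : Integrable phi := by
  simpa using integrable_exp_mul_abs_mul_phi 0

theorem integral_phi : ∫ ξ, phi ξ = 1 := by
  have h := ProbabilityTheory.integral_gaussianPDFReal_eq_one 0 (v := 1) one_ne_zero
  rw [← h]
  congr 1
  ext ξ
  simp [phi, ProbabilityTheory.gaussianPDFReal]

theorem hasDerivAt_phi (x : ℝ) : HasDerivAt phi (-x * phi x) x := by
  have h := (((hasDerivAt_id x).pow 2).neg.div_const 2).exp.const_mul (1 / Real.sqrt (2 * Real.pi))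
  refine (h.congr_deriv ?_)
  simp [phi]
  ring

theorem phi_le_exp (N x : ℝ) : phi x ≤ Real.exp (N ^ 2 / 2) * Real.exp (-N * x) := by
  have h1 : 1 / Real.sqrt (2 * Real.pi) ≤ 1 := by
    rw [div_le_one (by positivity), Real.one_le_sqrt]
    linarith [Real.pi_gt_three]
  calc phi x ≤ 1 * Real.exp (-x ^ 2 / 2) := by unfold phi; gcongr
    _ ≤ _ := by
      rw [one_mul, ← Real.exp_add]
      gcongr
      nlinarith [sq_nonneg (x - N)]

theorem hasDerivAt_Psi (x : ℝ) : HasDerivAt Psi (-phi x) x := by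
  have h : Psi = fun x => Psi 0 - ∫ y in (0 : ℝ)..x, phi y := by
    ext x
    rw [Psi, Psi, ← intervalIntegral.integral_Ioi_sub_Ioi' integrable_phi.integrableOn
      integrable_phi.integrableOn]
    ring
  rw [h]
  exact (continuous_phi.integral_hasStrictDerivAt 0 x).hasDerivAt.const_sub _

theorem abs_Psi_le_exp {N : ℝ} (hN : 0 ≤ N) :
    ∃ C, 0 ≤ C ∧ ∀ x, |Psi x| ≤ C * Real.exp (-N * x) := by
  have hint : Integrable fun ξ : ℝ => Real.exp (N * ξ) * phi ξ := by
    refine (integrable_exp_mul_abs_mul_phi N).mono'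
      (Continuous.aestronglyMeasurable (by fun_prop)) (ae_of_all _ fun ξ => ?_)
    rw [Real.norm_of_nonneg (mul_nonneg (Real.exp_pos _).le (phi_nonneg _))]
    have := phi_nonneg ξ
    gcongr
    exact le_abs_self ξ
  refine ⟨∫ ξ, Real.exp (N * ξ) * phi ξ,
    integral_nonneg fun ξ => mul_nonneg (Real.exp_pos _).le (phi_nonneg _), fun x => ?_⟩
  rw [Psi, abs_of_nonneg (integral_nonneg fun ξ => phi_nonneg _), ← integral_mul_const]
  have hint' := hint.mul_const (Real.exp (-N * x))
  calc ∫ ξ in Ioi x, phi ξ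
      ≤ ∫ ξ in Ioi x, Real.exp (N * ξ) * phi ξ * Real.exp (-N * x) := by
        refine setIntegral_mono_on integrable_phi.integrableOn hint'.integrableOn
          measurableSet_Ioi fun ξ hξ => ?_
        rw [mul_right_comm, ← Real.exp_add]
        refine le_mul_of_one_le_left (phi_nonneg _) (Real.one_le_exp ?_)
        nlinarith [mem_Ioi.1 hξ]
    _ ≤ ∫ ξ, Real.exp (N * ξ) * phi ξ * Real.exp (-N * x) :=
        setIntegral_le_integral hint' (ae_of_all _ fun ξ =>
          mul_nonneg (mul_nonneg (Real.exp_pos _).le (phi_nonneg _)) (Real.exp_pos _).le)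

/-! ### Functions of exponential growth at `-∞` and bounded at `+∞` -/

/-- `g` is bounded on `[0,∞)` and grows at most exponentially at `-∞`. -/
def LeftExpGrowth (g : ℝ → ℝ) : Prop :=
  ∃ C a, 0 ≤ C ∧ 0 ≤ a ∧ ∀ z, |g z| ≤ C * Real.exp (a * max (-z) 0)

theorem LeftExpGrowth.exists_bound {g : ℝ → ℝ} (hg : LeftExpGrowth g) (M r : ℝ) :
    ∃ B : ℝ → ℝ, Integrable B ∧ ∀ m t ξ, -m ≤ M → Real.sqrt t ≤ r →
      |g (m + Real.sqrt t * ξ) * phi ξ| ≤ B ξ := by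
  obtain ⟨C, a, hC, ha, h⟩ := hg
  refine ⟨fun ξ => C * Real.exp (a * |M|) * (Real.exp (a * r * |ξ|) * phi ξ),
    (integrable_exp_mul_abs_mul_phi _).const_mul _, fun m t ξ hm ht => ?_⟩
  rw [abs_mul, abs_of_nonneg (phi_nonneg ξ)]
  have hmax : max (-(m + Real.sqrt t * ξ)) 0 ≤ |M| + r * |ξ| := by
    have h0 := Real.sqrt_nonneg t
    have h1 : Real.sqrt t * |ξ| ≤ r * |ξ| := by gcongr
    have h2 : -(Real.sqrt t * ξ) ≤ Real.sqrt t * |ξ| := by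
      nlinarith [neg_abs_le ξ]
    refine max_le (by linarith [le_abs_self M]) ?_
    have : 0 ≤ Real.sqrt t * |ξ| := by positivity
    linarith [abs_nonneg M]
  calc |g (m + Real.sqrt t * ξ)| * phi ξ ≤ C * Real.exp (a * (|M| + r * |ξ|)) * phi ξ := by
        have := phi_nonneg ξ
        gcongr
        refine (h _).trans ?_
        gcongr
    _ = _ := by rw [mul_add, Real.exp_add]; ring_nf

/-! ### Heat evolution -/

/-- The heat evolution `𝔼 g(m + √t ξ)` with `ξ` a standard normal variable. -/
noncomputable def heatEv (g : ℝ → ℝ) (t m : ℝ) : ℝ := ∫ ξ, g (m + Real.sqrt t * ξ) * phi ξ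

theorem heatEv_zero (g : ℝ → ℝ) (m : ℝ) : heatEv g 0 m = g m := by
  simp [heatEv, integral_const_mul, integral_phi]

theorem continuous_heatEv {g : ℝ → ℝ} (hg : Continuous g) (hb : LeftExpGrowth g) :
    Continuous fun p : ℝ × ℝ => heatEv g p.1 p.2 := by
  rw [continuous_iff_continuousAt]
  rintro ⟨t, m⟩
  obtain ⟨B, hB, h⟩ := hb.exists_bound (-m + 1) (Real.sqrt t + 1)
  refine continuousAt_of_dominated (bound := B) ?_ ?_ hB ?_
  · exact Eventually.of_forall fun p => Continuous.aestronglyMeasurable (by fun_prop)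
  · have h1 : ∀ᶠ p : ℝ × ℝ in nhds (t, m), -p.2 < -m + 1 :=
      (continuous_snd.neg.tendsto (t, m)).eventually_lt_const (lt_add_one (-m))
    have h2 : ∀ᶠ p : ℝ × ℝ in nhds (t, m), Real.sqrt p.1 < Real.sqrt t + 1 :=
      (continuous_fst.sqrt.tendsto (t, m)).eventually_lt_const (lt_add_one (Real.sqrt t))
    filter_upwards [h1, h2] with p hp1 hp2
    exact ae_of_all _ fun ξ => h _ _ _ hp1.le hp2.le
  · exact ae_of_all _ fun ξ => Continuous.continuousAt (by fun_prop)

theorem exists_abs_heatEv_le {g : ℝ → ℝ} (hb : LeftExpGrowth g) (M r : ℝ) :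
    ∃ C, ∀ m t, -m ≤ M → Real.sqrt t ≤ r → |heatEv g t m| ≤ C := by
  obtain ⟨B, hB, h⟩ := hb.exists_bound M r
  refine ⟨∫ ξ, B ξ, fun m t hm ht => ?_⟩
  rw [heatEv, ← Real.norm_eq_abs]
  exact norm_integral_le_of_norm_le hB (ae_of_all _ fun ξ => h _ _ _ hm ht)

theorem tendsto_heatEv_atTop {g : ℝ → ℝ} (hg : Continuous g) (hb : LeftExpGrowth g)
    (h0 : Tendsto g atTop (nhds 0)) (t : ℝ) : Tendsto (heatEv g t) atTop (nhds 0) := by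
  obtain ⟨B, hB, h⟩ := hb.exists_bound 0 (Real.sqrt t)
  have := tendsto_integral_filter_of_dominated_convergence (μ := volume) (l := atTop)
    (F := fun m ξ => g (m + Real.sqrt t * ξ) * phi ξ) (f := fun _ => 0) B
    (Eventually.of_forall fun m => Continuous.aestronglyMeasurable (by fun_prop))
    ((eventually_ge_atTop 0).mono fun m hm => ae_of_all _ fun ξ => h _ _ _ (by linarith) le_rfl)
    hB (ae_of_all _ fun ξ => by
      simpa using (h0.comp (tendsto_atTop_add_const_right atTop (Real.sqrt t * ξ)
        tendsto_id)).mul_const (phi ξ))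
  change Tendsto (fun m => ∫ ξ, g (m + Real.sqrt t * ξ) * phi ξ) atTop (nhds 0)
  simpa using this

theorem hasDerivAt_heatEv {g g' : ℝ → ℝ} (hg : ∀ z, HasDerivAt g (g' z) z) (hg' : Continuous g')
    (hb : LeftExpGrowth g) (hb' : LeftExpGrowth g') (t m : ℝ) :
    HasDerivAt (heatEv g t) (heatEv g' t m) m := by
  have hgc : Continuous g := continuous_iff_continuousAt.2 fun z => (hg z).continuousAt
  obtain ⟨B, hB, h⟩ := hb'.exists_bound (-m + 1) (Real.sqrt t)
  obtain ⟨B', hB', h'⟩ := hb.exists_bound (-m) (Real.sqrt t)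
  refine (hasDerivAt_integral_of_dominated_loc_of_deriv_le (μ := volume) (bound := B)
    (F := fun m ξ => g (m + Real.sqrt t * ξ) * phi ξ)
    (F' := fun m ξ => g' (m + Real.sqrt t * ξ) * phi ξ)
    (Ioi_mem_nhds (sub_one_lt m)) ?_ ?_ ?_ ?_ hB ?_).2
  · exact Eventually.of_forall fun m => Continuous.aestronglyMeasurable (by fun_prop)
  · exact hB'.mono' (Continuous.aestronglyMeasurable (by fun_prop))
      (ae_of_all _ fun ξ => h' _ _ _ le_rfl le_rfl)
  · exact Continuous.aestronglyMeasurable (by fun_prop)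
  · exact ae_of_all _ fun ξ y hy => h _ _ _ (by linarith [mem_Ioi.1 hy]) le_rfl
  · exact ae_of_all _ fun ξ y _ =>
      ((hg (y + Real.sqrt t * ξ)).comp_add_const y (Real.sqrt t * ξ)).mul_const (phi ξ)

/-! ### Smoothness and the heat equation for positive times -/

/-- The moments `∫ g(z) zⁿ e^{az - bz²} dz` as functions of `p = (a, b)`. -/
noncomputable def gaussMoment (g : ℝ → ℝ) (n : ℕ) (p : ℝ × ℝ) : ℝ :=
  ∫ z, g z * z ^ n * Real.exp (p.1 * z - p.2 * z ^ 2)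

theorem exists_bound_gaussMoment {g : ℝ → ℝ} (hb : LeftExpGrowth g) (n : ℕ) (A : ℝ) {b : ℝ}
    (hb0 : 0 < b) : ∃ B : ℝ → ℝ, Integrable B ∧ ∀ (p : ℝ × ℝ) (z : ℝ), |p.1| ≤ A → b ≤ p.2 →
      ‖g z * z ^ n * Real.exp (p.1 * z - p.2 * z ^ 2)‖ ≤ B z := by
  obtain ⟨C, a, hC, ha, h⟩ := hb
  refine ⟨fun z => C * (|z| ^ n * Real.exp ((a + A) * |z| - b * z ^ 2)),
    (integrable_abs_pow_mul_exp n _ hb0).const_mul _, fun p z hp1 hp2 => ?_⟩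
  rw [norm_mul, norm_mul, norm_pow, Real.norm_eq_abs, Real.norm_eq_abs,
    Real.norm_of_nonneg (Real.exp_pos _).le]
  have h1 : |g z| ≤ C * Real.exp (a * |z|) := by
    refine (h z).trans ?_
    gcongr
    exact max_le (neg_le_abs z) (abs_nonneg z)
  have h2 : p.1 * z - p.2 * z ^ 2 ≤ A * |z| - b * z ^ 2 := by
    have h3 : p.1 * z ≤ A * |z| := (le_abs_self _).trans (by rw [abs_mul]; gcongr)
    have h4 : b * z ^ 2 ≤ p.2 * z ^ 2 := by gcongr
    linarith
  calc _ ≤ C * Real.exp (a * |z|) * |z| ^ n * Real.exp (A * |z| - b * z ^ 2) := by gcongr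
    _ = C * (|z| ^ n * (Real.exp (a * |z|) * Real.exp (A * |z| - b * z ^ 2))) := by ring
    _ = _ := by rw [← Real.exp_add]; ring_nf

theorem integrable_gaussMoment {g : ℝ → ℝ} (hg : Continuous g) (hb : LeftExpGrowth g) (n : ℕ)
    {p : ℝ × ℝ} (hp : 0 < p.2) :
    Integrable fun z => g z * z ^ n * Real.exp (p.1 * z - p.2 * z ^ 2) := by
  obtain ⟨B, hB, h⟩ := exists_bound_gaussMoment hb n |p.1| hp
  exact hB.mono' (Continuous.aestronglyMeasurable (by fun_prop))
    (ae_of_all _ fun z => h p z le_rfl le_rfl)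

theorem hasFDerivAt_gaussMoment {g : ℝ → ℝ} (hg : Continuous g) (hb : LeftExpGrowth g) (n : ℕ)
    {p : ℝ × ℝ} (hp : 0 < p.2) :
    HasFDerivAt (gaussMoment g n)
      (gaussMoment g (n + 1) p • ContinuousLinearMap.fst ℝ ℝ ℝ -
        gaussMoment g (n + 2) p • ContinuousLinearMap.snd ℝ ℝ ℝ) p := by
  obtain ⟨B₁, hB₁, h₁⟩ := exists_bound_gaussMoment hb (n + 1) (|p.1| + 1) (half_pos hp)
  obtain ⟨B₂, hB₂, h₂⟩ := exists_bound_gaussMoment hb (n + 2) (|p.1| + 1) (half_pos hp)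
  have hs : {q : ℝ × ℝ | |q.1| < |p.1| + 1 ∧ p.2 / 2 < q.2} ∈ nhds p :=
    ((continuous_fst.abs.tendsto p).eventually_lt_const (lt_add_one |p.1|)).and
      ((continuous_snd.tendsto p).eventually_const_lt (half_lt_self hp))
  have hint : ∫ z, ((g z * z ^ (n + 1) * Real.exp (p.1 * z - p.2 * z ^ 2)) •
        ContinuousLinearMap.fst ℝ ℝ ℝ -
      (g z * z ^ (n + 2) * Real.exp (p.1 * z - p.2 * z ^ 2)) •
        ContinuousLinearMap.snd ℝ ℝ ℝ) =
      gaussMoment g (n + 1) p • ContinuousLinearMap.fst ℝ ℝ ℝ -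
        gaussMoment g (n + 2) p • ContinuousLinearMap.snd ℝ ℝ ℝ := by
    rw [integral_sub ((integrable_gaussMoment hg hb _ hp).smul_const _)
      ((integrable_gaussMoment hg hb _ hp).smul_const _), integral_smul_const, integral_smul_const]
    rfl
  rw [← hint]
  refine hasFDerivAt_integral_of_dominated_of_fderiv_le (μ := volume)
    (F := fun q z => g z * z ^ n * Real.exp (q.1 * z - q.2 * z ^ 2))
    (bound := fun z => B₁ z * ‖ContinuousLinearMap.fst ℝ ℝ ℝ‖ +
      B₂ z * ‖ContinuousLinearMap.snd ℝ ℝ ℝ‖)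
    (F' := fun q z => (g z * z ^ (n + 1) * Real.exp (q.1 * z - q.2 * z ^ 2)) •
        ContinuousLinearMap.fst ℝ ℝ ℝ -
      (g z * z ^ (n + 2) * Real.exp (q.1 * z - q.2 * z ^ 2)) •
        ContinuousLinearMap.snd ℝ ℝ ℝ) hs ?_ (integrable_gaussMoment hg hb n hp) ?_ ?_ ?_ ?_
  · exact Eventually.of_forall fun q => Continuous.aestronglyMeasurable (by fun_prop)
  · exact Continuous.aestronglyMeasurable (by fun_prop)
  · refine ae_of_all _ fun z q hq => (norm_sub_le _ _).trans ?_
    rw [norm_smul, norm_smul]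
    gcongr
    · exact h₁ q z hq.1.le hq.2.le
    · exact h₂ q z hq.1.le hq.2.le
  · exact (hB₁.mul_const _).add (hB₂.mul_const _)
  · refine ae_of_all _ fun z q _ => ?_
    have h := (((hasFDerivAt_fst (𝕜 := ℝ) (p := q)).mul_const z).sub
      ((hasFDerivAt_snd (𝕜 := ℝ) (p := q)).mul_const (z ^ 2))).exp.const_mul (g z * z ^ n)
    refine h.congr_fderiv ?_
    ext <;> simp <;> ring

theorem contDiffOn_gaussMoment {g : ℝ → ℝ} (hg : Continuous g) (hb : LeftExpGrowth g) (n : ℕ) :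
    ContDiffOn ℝ (⊤ : ℕ∞) (gaussMoment g n) {p | 0 < p.2} := by
  have hopen : IsOpen {p : ℝ × ℝ | 0 < p.2} := isOpen_lt continuous_const continuous_snd
  rw [contDiffOn_infty]
  intro k
  induction k generalizing n with
  | zero =>
    exact contDiffOn_zero.2 fun p hp =>
      (hasFDerivAt_gaussMoment hg hb n hp).continuousAt.continuousWithinAt
  | succ k ih =>
    rw [Nat.cast_add, Nat.cast_one, contDiffOn_succ_iff_fderiv_of_isOpen hopen]
    refine ⟨fun p hp =>
      (hasFDerivAt_gaussMoment hg hb n hp).differentiableAt.differentiableWithinAt, by simp, ?_⟩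
    exact (((ih (n + 1)).smul contDiffOn_const).sub ((ih (n + 2)).smul contDiffOn_const)).congr
      fun p hp => (hasFDerivAt_gaussMoment hg hb n hp).fderiv

theorem hasDerivAt_gaussMoment_comp {g : ℝ → ℝ} (hg : Continuous g) (hb : LeftExpGrowth g) (n : ℕ)
    {a b : ℝ → ℝ} {a' b' x : ℝ} (ha : HasDerivAt a a' x) (hb' : HasDerivAt b b' x)
    (hpos : 0 < b x) :
    HasDerivAt (fun y => gaussMoment g n (a y, b y))
      (gaussMoment g (n + 1) (a x, b x) * a' - gaussMoment g (n + 2) (a x, b x) * b') x := by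
  have h := (hasFDerivAt_gaussMoment hg hb n (p := (a x, b x)) hpos).comp_hasDerivAt x
    (ha.prodMk hb')
  refine h.congr_deriv ?_
  simp

/-- The prefactor `(2πt)^{-1/2} e^{-m²/(2t)}` of the heat kernel. -/
noncomputable def heatFactor (t m : ℝ) : ℝ :=
  (Real.sqrt (2 * Real.pi * t))⁻¹ * Real.exp (-m ^ 2 / (2 * t))

theorem heatKernel_eq {t : ℝ} (ht : 0 < t) (m z : ℝ) :
    1 / Real.sqrt t * phi ((m - z) / Real.sqrt t) =
      heatFactor t m * Real.exp (m / t * z - 1 / (2 * t) * z ^ 2) := by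
  rw [heatFactor, phi, mul_assoc, ← Real.exp_add, div_pow, Real.sq_sqrt ht.le,
    Real.sqrt_mul (by positivity) t, one_div, one_div, mul_inv, ← mul_assoc, neg_div' _ _,
    mul_comm (Real.sqrt t)⁻¹]
  congr 2
  field_simp
  ring

theorem heatEv_eq_integral (g : ℝ → ℝ) {t : ℝ} (ht : 0 < t) (m : ℝ) :
    heatEv g t m = ∫ z, g z * (1 / Real.sqrt t * phi ((m - z) / Real.sqrt t)) := by
  have hs : 0 < Real.sqrt t := Real.sqrt_pos.2 ht
  have h1 := integral_add_left_eq_self (μ := volume)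
    (fun z => g z * (1 / Real.sqrt t * phi ((m - z) / Real.sqrt t))) m
  have h2 := Measure.integral_comp_mul_left
    (fun z => g (m + z) * (1 / Real.sqrt t * phi ((m - (m + z)) / Real.sqrt t))) (Real.sqrt t)
  rw [← h1, heatEv, ← inv_smul_smul₀ hs.ne' (∫ z, g (m + z) * _), ← abs_of_pos (inv_pos.2 hs),
    smul_comm, ← h2, smul_eq_mul, ← integral_const_mul]
  congr 1
  ext ξ
  rw [show (m - (m + Real.sqrt t * ξ)) / Real.sqrt t = -ξ by field_simp; ring]
  simp only [phi, neg_sq]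
  field_simp

theorem heatEv_eq_gaussMoment (g : ℝ → ℝ) {t : ℝ} (ht : 0 < t) (m : ℝ) :
    heatEv g t m = heatFactor t m * gaussMoment g 0 (m / t, 1 / (2 * t)) := by
  rw [heatEv_eq_integral g ht, gaussMoment, ← integral_const_mul]
  congr 1
  ext z
  rw [heatKernel_eq ht]
  ring

theorem hasDerivAt_heatFactor_right {t : ℝ} (ht : 0 < t) (m : ℝ) :
    HasDerivAt (heatFactor t) (-(m / t) * heatFactor t m) m := by
  have h := (((hasDerivAt_id m).pow 2).neg.div_const (2 * t)).exp.const_mul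
    (Real.sqrt (2 * Real.pi * t))⁻¹
  refine h.congr_deriv ?_
  simp [heatFactor]
  field_simp

theorem hasDerivAt_heatFactor {m : ℝ → ℝ} {m' t : ℝ} (ht : 0 < t) (hm : HasDerivAt m m' t) :
    HasDerivAt (fun s => heatFactor s (m s))
      ((-1 / (2 * t) + m t ^ 2 / (2 * t ^ 2) - m t * m' / t) * heatFactor t (m t)) t := by
  have hpos : 0 < 2 * Real.pi * t := by positivity
  have hs := Real.sqrt_pos.2 hpos
  have h1 := (((hasDerivAt_id t).const_mul (2 * Real.pi)).sqrt hpos.ne').inv hs.ne'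
  have h2 := ((hm.pow 2).neg.div ((hasDerivAt_id t).const_mul 2) (by simpa using ht.ne')).exp
  refine (h1.mul h2).congr_deriv ?_
  simp only [heatFactor, id, Pi.pow_apply, Pi.neg_apply, Pi.div_apply, Pi.inv_apply]
  rw [Real.sq_sqrt hpos.le]
  generalize Real.sqrt (2 * Real.pi * t) = r at *
  field_simp
  push_cast
  ring

theorem contDiffOn_heatEv {g : ℝ → ℝ} (hg : Continuous g) (hb : LeftExpGrowth g) :
    ContDiffOn ℝ (⊤ : ℕ∞) (fun p : ℝ × ℝ => heatEv g p.1 p.2) {p | 0 < p.1} := by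
  have h0 : ∀ p ∈ {p : ℝ × ℝ | 0 < p.1}, p.1 ≠ 0 := fun p hp => ne_of_gt hp
  have h1 : ContDiffOn ℝ (⊤ : ℕ∞) (fun p : ℝ × ℝ => heatFactor p.1 p.2) {p | 0 < p.1} := by
    unfold heatFactor
    refine ContDiffOn.mul (ContDiffOn.inv (ContDiffOn.sqrt (by fun_prop) ?_) ?_)
      (ContDiffOn.exp (ContDiffOn.div (by fun_prop) (by fun_prop) ?_))
    · intro p hp
      exact mul_ne_zero (by positivity) (h0 p hp)
    · intro p hp
      have : 0 < p.1 := hp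
      positivity
    · intro p hp
      exact mul_ne_zero two_ne_zero (h0 p hp)
  have h2 : ContDiffOn ℝ (⊤ : ℕ∞)
      (fun p : ℝ × ℝ => gaussMoment g 0 (p.2 / p.1, 1 / (2 * p.1))) {p | 0 < p.1} := by
    refine (contDiffOn_gaussMoment hg hb 0).comp
      (ContDiffOn.prodMk (ContDiffOn.div (by fun_prop) (by fun_prop) h0)
        (ContDiffOn.div (by fun_prop) (by fun_prop) ?_)) ?_
    · intro p hp
      exact mul_ne_zero two_ne_zero (h0 p hp)
    · intro p hp
      have : 0 < p.1 := hp
      change 0 < 1 / (2 * p.1)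
      positivity
  exact (h1.mul h2).congr fun p hp => heatEv_eq_gaussMoment g hp p.2

/-- The spatial derivative of the heat evolution in terms of Gaussian moments. -/
theorem hasDerivAt_heatEv_right {g : ℝ → ℝ} (hg : Continuous g) (hb : LeftExpGrowth g) {t : ℝ}
    (ht : 0 < t) (m : ℝ) :
    HasDerivAt (heatEv g t) (heatFactor t m *
      (gaussMoment g 1 (m / t, 1 / (2 * t)) / t - m / t * gaussMoment g 0 (m / t, 1 / (2 * t))))
      m := by
  have h1 := (hasDerivAt_heatFactor_right ht m).mul
    (hasDerivAt_gaussMoment_comp hg hb 0 ((hasDerivAt_id m).div_const t)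
      (hasDerivAt_const m (1 / (2 * t))) (by positivity))
  refine (h1.congr_of_eventuallyEq (Eventually.of_forall fun y =>
    heatEv_eq_gaussMoment g ht y)).congr_deriv ?_
  simp only [id]
  ring

/-- The heat equation along a moving frame `m(t)`, where `g'` is the derivative of `g`. -/
theorem hasDerivAt_heatEv_moving {g g' : ℝ → ℝ} (hg : ∀ z, HasDerivAt g (g' z) z)
    (hg' : Continuous g') (hb : LeftExpGrowth g) (hb' : LeftExpGrowth g') {m : ℝ → ℝ}
    {m' t v : ℝ} (ht : 0 < t) (hm : HasDerivAt m m' t) (hv : HasDerivAt (heatEv g' t) v (m t)) :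
    HasDerivAt (fun s => heatEv g s (m s)) (m' * heatEv g' t (m t) + 1 / 2 * v) t := by
  have hgc : Continuous g := continuous_iff_continuousAt.2 fun z => (hg z).continuousAt
  have hV : heatEv g' t = fun m => heatFactor t m *
      (gaussMoment g 1 (m / t, 1 / (2 * t)) / t -
        m / t * gaussMoment g 0 (m / t, 1 / (2 * t))) :=
    funext fun m => (hasDerivAt_heatEv hg hg' hb hb' t m).unique
      (hasDerivAt_heatEv_right hgc hb ht m)
  have hM := fun n => hasDerivAt_gaussMoment_comp hgc hb n ((hasDerivAt_id (m t)).div_const t)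
      (hasDerivAt_const (m t) (1 / (2 * t))) (by positivity)
  have hv' := (hV ▸ hv).unique ((hasDerivAt_heatFactor_right ht (m t)).mul
    (((hM 1).div_const t).sub (((hasDerivAt_id (m t)).div_const t).mul (hM 0))))
  have h := (hasDerivAt_heatFactor ht hm).mul
    (hasDerivAt_gaussMoment_comp hgc hb 0 (hm.div (hasDerivAt_id t) ht.ne')
      ((hasDerivAt_const t (1 : ℝ)).div ((hasDerivAt_id t).const_mul 2) (by simpa using ht.ne'))
      (by simpa using ht))
  refine (h.congr_of_eventuallyEq ((eventually_gt_nhds ht).mono fun s hs =>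
    heatEv_eq_gaussMoment g hs (m s))).congr_deriv ?_
  rw [hv', hV]
  simp only [id, Pi.div_apply]
  field_simp
  ring

/-! ### Growth and decay on the half-line -/

/-- `F` grows at most exponentially on `[0,∞)`. -/
def RightExpGrowth (F : ℝ → ℝ) : Prop :=
  ∃ C a, 0 ≤ C ∧ 0 ≤ a ∧ ∀ y, 0 ≤ y → |F y| ≤ C * Real.exp (a * y)

/-- `F` decays faster than every exponential on `[0,∞)`. -/
def RightExpDecay (F : ℝ → ℝ) : Prop :=
  ∀ N : ℝ, 0 ≤ N → ∃ C, 0 ≤ C ∧ ∀ y, 0 ≤ y → |F y| ≤ C * Real.exp (-N * y)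

theorem RightExpGrowth.of_abs_le {F : ℝ → ℝ} {C : ℝ} (h : ∀ y, 0 ≤ y → |F y| ≤ C) :
    RightExpGrowth F :=
  ⟨C, 0, (abs_nonneg _).trans (h 0 le_rfl), le_rfl, fun y hy => by simpa using h y hy⟩

theorem RightExpGrowth.const (c : ℝ) : RightExpGrowth fun _ => c :=
  .of_abs_le fun _ _ => le_rfl

theorem RightExpGrowth.exp (b : ℝ) : RightExpGrowth fun y => Real.exp (b * y) :=
  ⟨1, |b|, zero_le_one, abs_nonneg b, fun y hy => by
    rw [one_mul, abs_of_pos (Real.exp_pos _)]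
    gcongr
    exact le_abs_self b⟩

theorem RightExpGrowth.mul {F G : ℝ → ℝ} (hF : RightExpGrowth F) (hG : RightExpGrowth G) :
    RightExpGrowth fun y => F y * G y := by
  obtain ⟨C, a, hC, ha, h⟩ := hF
  obtain ⟨C', a', hC', ha', h'⟩ := hG
  refine ⟨C * C', a + a', by positivity, by positivity, fun y hy => ?_⟩
  rw [abs_mul, add_mul, Real.exp_add]
  calc _ ≤ (C * Real.exp (a * y)) * (C' * Real.exp (a' * y)) :=
        mul_le_mul (h y hy) (h' y hy) (abs_nonneg _) (by positivity)
    _ = _ := by ring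

theorem RightExpGrowth.add {F G : ℝ → ℝ} (hF : RightExpGrowth F) (hG : RightExpGrowth G) :
    RightExpGrowth fun y => F y + G y := by
  obtain ⟨C, a, hC, ha, h⟩ := hF
  obtain ⟨C', a', hC', ha', h'⟩ := hG
  refine ⟨C + C', max a a', by positivity, le_max_of_le_left ha, fun y hy => ?_⟩
  rw [add_mul]
  refine (abs_add_le _ _).trans (add_le_add ((h y hy).trans ?_) ((h' y hy).trans ?_))
  · gcongr
    exact le_max_left _ _
  · gcongr
    exact le_max_right _ _

theorem RightExpGrowth.abs {F : ℝ → ℝ} (hF : RightExpGrowth F) :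
    RightExpGrowth fun y => |F y| := by
  simpa [RightExpGrowth] using hF

theorem RightExpGrowth.mul_decay {F G : ℝ → ℝ} (hF : RightExpGrowth F) (hG : RightExpDecay G) :
    RightExpDecay fun y => F y * G y := by
  obtain ⟨C, a, hC, ha, h⟩ := hF
  intro N hN
  obtain ⟨C', hC', h'⟩ := hG (a + N) (by positivity)
  refine ⟨C * C', by positivity, fun y hy => ?_⟩
  rw [abs_mul]
  calc _ ≤ (C * Real.exp (a * y)) * (C' * Real.exp (-(a + N) * y)) :=
        mul_le_mul (h y hy) (h' y hy) (abs_nonneg _) (by positivity)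
    _ = C * C' * (Real.exp (a * y) * Real.exp (-(a + N) * y)) := by ring
    _ = _ := by rw [← Real.exp_add]; ring_nf

theorem RightExpDecay.const_mul {F : ℝ → ℝ} (hF : RightExpDecay F) (c : ℝ) :
    RightExpDecay fun y => c * F y :=
  (RightExpGrowth.const c).mul_decay hF

theorem RightExpDecay.add {F G : ℝ → ℝ} (hF : RightExpDecay F) (hG : RightExpDecay G) :
    RightExpDecay fun y => F y + G y := by
  intro N hN
  obtain ⟨C, hC, h⟩ := hF N hN
  obtain ⟨C', hC', h'⟩ := hG N hN
  refine ⟨C + C', by positivity, fun y hy => ?_⟩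
  rw [add_mul]
  exact (abs_add_le _ _).trans (add_le_add (h y hy) (h' y hy))

theorem RightExpDecay.sub {F G : ℝ → ℝ} (hF : RightExpDecay F) (hG : RightExpDecay G) :
    RightExpDecay fun y => F y - G y := by
  simpa [sub_eq_add_neg] using hF.add (hG.const_mul (-1))

theorem RightExpDecay.tendsto {F : ℝ → ℝ} (hF : RightExpDecay F) : Tendsto F atTop (nhds 0) := by
  obtain ⟨C, -, h⟩ := hF 1 zero_le_one
  refine squeeze_zero_norm' ((eventually_ge_atTop 0).mono fun y hy => h y hy) ?_
  simpa using (Real.tendsto_exp_neg_atTop_nhds_zero).const_mul C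

theorem RightExpDecay.integrableOn {F : ℝ → ℝ} (hF : RightExpDecay F) (hc : Continuous F) :
    IntegrableOn F (Ioi 0) := by
  obtain ⟨C, -, h⟩ := hF 1 zero_le_one
  refine ((integrableOn_exp_mul_Ioi (by norm_num : (-1 : ℝ) < 0) 0).const_mul C).mono'
    hc.aestronglyMeasurable ?_
  exact (ae_restrict_mem measurableSet_Ioi).mono fun y hy => h y (le_of_lt hy)

theorem rightExpDecay_phi {s : ℝ} (hs : 0 < s) (c : ℝ) :
    RightExpDecay fun y => phi ((c + y) / s) := by
  refine fun N _ => ⟨Real.exp ((N * s) ^ 2 / 2) * Real.exp (-N * c), by positivity, fun y _ => ?_⟩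
  rw [abs_of_nonneg (phi_nonneg _), mul_assoc, ← Real.exp_add]
  refine (phi_le_exp (N * s) _).trans_eq ?_
  congr 2
  field_simp
  ring

theorem rightExpDecay_Psi {s : ℝ} (hs : 0 < s) (c : ℝ) :
    RightExpDecay fun y => Psi ((c + y) / s) := by
  intro N hN
  obtain ⟨C, hC, h⟩ := abs_Psi_le_exp (mul_nonneg hN hs.le)
  refine ⟨C * Real.exp (-N * c), by positivity, fun y _ => (h _).trans_eq ?_⟩
  rw [mul_assoc, ← Real.exp_add]
  congr 2
  field_simp
  ring

theorem LeftExpGrowth.neg_right {g : ℝ → ℝ} (hg : LeftExpGrowth g) :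
    RightExpGrowth fun y => g (-y) := by
  obtain ⟨C, a, hC, ha, h⟩ := hg
  refine ⟨C, a, hC, ha, fun y hy => ?_⟩
  simpa [hy] using h (-y)

theorem LeftExpGrowth.right {g : ℝ → ℝ} (hg : LeftExpGrowth g) : RightExpGrowth g := by
  obtain ⟨C, a, hC, ha, h⟩ := hg
  exact .of_abs_le fun y hy => by simpa [hy] using h y

theorem integral_eq_integral_Ioi_add_neg {F : ℝ → ℝ} (hF : Integrable F) :
    ∫ z, F z = ∫ y in Ioi 0, (F y + F (-y)) := by
  rw [← intervalIntegral.integral_Iic_add_Ioi hF.integrableOn hF.integrableOn (b := 0),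
    integral_add hF.integrableOn hF.comp_neg.integrableOn, integral_comp_neg_Ioi, neg_zero, add_comm]

theorem integral_Ioi_eq_neg_of_decay {A A' : ℝ → ℝ} (hA : ∀ y, 0 ≤ y → HasDerivAt A (A' y) y)
    (hint : IntegrableOn A' (Ioi 0)) (hdec : RightExpDecay A) : ∫ y in Ioi 0, A' y = -A 0 := by
  rw [integral_Ioi_of_hasDerivAt_of_tendsto' (fun y hy => hA y hy) hint hdec.tendsto, zero_sub]

/-! ### The extension of the initial data to the whole line -/

/-- The primitive `∫₀ˢ e^{2νy} D(y) dy`. -/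
noncomputable def expPrimitive (ν : ℝ) (D : ℝ → ℝ) (s : ℝ) : ℝ :=
  ∫ y in (0 : ℝ)..s, Real.exp (2 * ν * y) * D y

/-- The extension of the derivative `D` of the initial data from `[0,∞)` to `ℝ`, chosen in such a
way that the heat evolution in the frame `x + μt` satisfies the boundary condition at `0`. -/
noncomputable def extSlope (μ ν : ℝ) (D : ℝ → ℝ) (z : ℝ) : ℝ :=
  Real.exp (2 * μ * max (-z) 0) * D |z| -
    2 * (2 * ν - μ) * Real.exp (-2 * (ν - μ) * max (-z) 0) * expPrimitive ν D (max (-z) 0)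

theorem hasDerivAt_expPrimitive (ν : ℝ) {D : ℝ → ℝ} (hD : Continuous D) (s : ℝ) :
    HasDerivAt (expPrimitive ν D) (Real.exp (2 * ν * s) * D s) s :=
  (Continuous.integral_hasStrictDerivAt (by fun_prop) 0 s).hasDerivAt

theorem continuous_expPrimitive (ν : ℝ) {D : ℝ → ℝ} (hD : Continuous D) :
    Continuous (expPrimitive ν D) :=
  continuous_iff_continuousAt.2 fun s => (hasDerivAt_expPrimitive ν hD s).continuousAt

theorem expPrimitive_zero (ν : ℝ) (D : ℝ → ℝ) : expPrimitive ν D 0 = 0 := by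
  simp [expPrimitive]

theorem rightExpGrowth_primitive {F : ℝ → ℝ} (hF : RightExpGrowth F) :
    RightExpGrowth fun s => ∫ y in (0 : ℝ)..s, F y := by
  obtain ⟨C, a, hC, ha, h⟩ := hF
  refine ⟨C, a + 1, hC, by positivity, fun s hs => ?_⟩
  have h1 : ‖∫ y in (0 : ℝ)..s, F y‖ ≤ C * Real.exp (a * s) * |s - 0| := by
    refine intervalIntegral.norm_integral_le_of_norm_le_const fun y hy => ?_
    rw [uIoc_of_le hs] at hy
    refine (h y hy.1.le).trans ?_
    gcongr
    exact hy.2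
  have h2 : s ≤ Real.exp s := by linarith [Real.add_one_le_exp s]
  calc _ ≤ C * Real.exp (a * s) * |s - 0| := h1
    _ ≤ C * Real.exp (a * s) * Real.exp s := by rw [sub_zero, abs_of_nonneg hs]; gcongr
    _ = _ := by rw [mul_assoc, ← Real.exp_add]; ring_nf

theorem extSlope_of_nonneg (μ ν : ℝ) (D : ℝ → ℝ) {z : ℝ} (hz : 0 ≤ z) :
    extSlope μ ν D z = D z := by
  simp [extSlope, hz, expPrimitive_zero, abs_of_nonneg hz]

theorem extSlope_neg (μ ν : ℝ) (D : ℝ → ℝ) {y : ℝ} (hy : 0 ≤ y) :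
    extSlope μ ν D (-y) = Real.exp (2 * μ * y) * D y -
      2 * (2 * ν - μ) * Real.exp (-2 * (ν - μ) * y) * expPrimitive ν D y := by
  simp [extSlope, hy, abs_of_nonneg hy]

theorem continuous_extSlope (μ ν : ℝ) {D : ℝ → ℝ} (hD : Continuous D) :
    Continuous (extSlope μ ν D) := by
  have := continuous_expPrimitive ν hD
  unfold extSlope
  fun_prop

theorem leftExpGrowth_extSlope (μ ν : ℝ) {D : ℝ → ℝ} {C : ℝ} (hC : ∀ y, |D y| ≤ C) :
    LeftExpGrowth (extSlope μ ν D) := by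
  have hD : RightExpGrowth D := .of_abs_le fun y _ => hC y
  have hK : RightExpGrowth (expPrimitive ν D) :=
    rightExpGrowth_primitive ((RightExpGrowth.exp (2 * ν)).mul hD)
  obtain ⟨B, a, hB, ha, h⟩ := ((RightExpGrowth.exp (2 * μ)).mul (.const C)).add
    (((RightExpGrowth.const (2 * (2 * ν - μ))).mul (.exp (-2 * (ν - μ)))).mul hK).abs
  refine ⟨B, a, hB, ha, fun z => le_trans ?_ ((le_abs_self _).trans (h (max (-z) 0)
    (le_max_right _ _)))⟩
  refine (abs_sub _ _).trans (add_le_add ?_ le_rfl)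
  rw [abs_mul, abs_of_pos (Real.exp_pos _)]
  gcongr
  exact hC _

theorem leftExpGrowth_of_hasDerivAt {g g' : ℝ → ℝ} (hg : ∀ z, HasDerivAt g (g' z) z)
    (hg' : Continuous g') (hb' : LeftExpGrowth g') {C : ℝ} (hC : ∀ z, 0 ≤ z → |g z| ≤ C) :
    LeftExpGrowth g := by
  obtain ⟨B, a, hB, ha, h⟩ := (RightExpGrowth.const C).add
    (rightExpGrowth_primitive hb'.neg_right).abs
  have hC0 : 0 ≤ C := (abs_nonneg _).trans (hC 0 le_rfl)
  refine ⟨B, a, hB, ha, fun z => le_trans ?_ ((le_abs_self _).trans (h (max (-z) 0)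
    (le_max_right _ _)))⟩
  rcases le_total 0 z with hz | hz
  · exact (hC z hz).trans (le_add_of_nonneg_right (abs_nonneg _))
  · beta_reduce
    rw [max_eq_left (neg_nonneg.2 hz), intervalIntegral.integral_comp_neg, neg_neg, neg_zero,
      intervalIntegral.integral_eq_sub_of_hasDerivAt (fun x _ => hg x)
        (hg'.intervalIntegrable _ _)]
    calc |g z| = |g 0 - (g 0 - g z)| := by ring_nf
      _ ≤ |g 0| + |g 0 - g z| := abs_sub _ _
      _ ≤ _ := by gcongr; exact hC 0 le_rfl

/-! ### The boundary condition -/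

theorem robin_gaussMoment_extSlope (μ ν : ℝ) {D : ℝ → ℝ} (hD : Continuous D) {C : ℝ}
    (hC : ∀ y, |D y| ≤ C) {t : ℝ} (ht : 0 < t) :
    gaussMoment (extSlope μ ν D) 1 (μ, 1 / (2 * t)) / (2 * t) +
      (μ / 2 - ν) * gaussMoment (extSlope μ ν D) 0 (μ, 1 / (2 * t)) = 0 := by
  have hc := continuous_extSlope μ ν hD
  have hb := leftExpGrowth_extSlope μ ν hC
  have hp : 0 < ((μ, 1 / (2 * t)) : ℝ × ℝ).2 := by positivity
  have h1 := (integrable_gaussMoment hc hb 1 hp).div_const (2 * t)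
  have h0 := (integrable_gaussMoment hc hb 0 hp).const_mul (μ / 2 - ν)
  have hK : RightExpGrowth (expPrimitive ν D) :=
    rightExpGrowth_primitive ((RightExpGrowth.exp (2 * ν)).mul (.of_abs_le fun y _ => hC y))
  have hdec : RightExpDecay fun y => Real.exp (-(1 / (2 * t)) * y ^ 2) := by
    refine fun N _ => ⟨Real.exp (N ^ 2 * t / 2), by positivity, fun y _ => ?_⟩
    rw [abs_of_pos (Real.exp_pos _), ← Real.exp_add]
    gcongr
    have h : N ^ 2 * t / 2 + -N * y - -(1 / (2 * t)) * y ^ 2 = (N * t - y) ^ 2 / (2 * t) := by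
      field_simp; ring
    have : 0 ≤ (N * t - y) ^ 2 / (2 * t) := by positivity
    linarith
  rw [gaussMoment, gaussMoment, ← integral_div, ← integral_const_mul, ← integral_add h1 h0]
  refine (integral_eq_integral_Ioi_add_neg (h1.add h0)).trans ?_
  have hA : ∀ y, 0 ≤ y → HasDerivAt (fun y => (μ - 2 * ν) * (Real.exp ((μ - 2 * ν) * y) *
      expPrimitive ν D y * Real.exp (-(1 / (2 * t)) * y ^ 2))) _ y := fun y _ =>
    (((((hasDerivAt_id y).const_mul (μ - 2 * ν)).exp.mul (hasDerivAt_expPrimitive ν hD y)).mul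
      (((hasDerivAt_id y).pow 2).const_mul (-(1 / (2 * t)))).exp)).const_mul (μ - 2 * ν)
  refine (integral_Ioi_eq_neg_of_decay (A' := fun y =>
      (extSlope μ ν D y * y ^ 1 * Real.exp (μ * y - 1 / (2 * t) * y ^ 2) / (2 * t) +
      (μ / 2 - ν) * (extSlope μ ν D y * y ^ 0 * Real.exp (μ * y - 1 / (2 * t) * y ^ 2))) +
      (extSlope μ ν D (-y) * (-y) ^ 1 * Real.exp (μ * (-y) - 1 / (2 * t) * (-y) ^ 2) / (2 * t) +
      (μ / 2 - ν) * (extSlope μ ν D (-y) * (-y) ^ 0 *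
        Real.exp (μ * (-y) - 1 / (2 * t) * (-y) ^ 2))))
    (fun y hy => (hA y hy).congr_deriv ?_) ?_ ?_).trans ?_
  rotate_right
  · simp [expPrimitive_zero]
  · rw [extSlope_of_nonneg μ ν D hy, extSlope_neg μ ν D hy]
    have e1 : Real.exp (μ * y - 1 / (2 * t) * y ^ 2) =
        Real.exp (μ * y) * Real.exp (-(1 / (2 * t)) * y ^ 2) := by
      rw [← Real.exp_add]; ring_nf
    have e2 : Real.exp (μ * (-y) - 1 / (2 * t) * (-y) ^ 2) =
        (Real.exp (μ * y))⁻¹ * Real.exp (-(1 / (2 * t)) * y ^ 2) := by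
      rw [← Real.exp_neg, ← Real.exp_add]; ring_nf
    have e3 : Real.exp (2 * μ * y) = Real.exp (μ * y) ^ 2 := by
      rw [← Real.exp_nat_mul]; push_cast; ring_nf
    have e4 : Real.exp (2 * ν * y) = Real.exp (ν * y) ^ 2 := by
      rw [← Real.exp_nat_mul]; push_cast; ring_nf
    have e5 : Real.exp (-2 * (ν - μ) * y) = Real.exp (μ * y) ^ 2 / Real.exp (ν * y) ^ 2 := by
      rw [← e3, ← e4, ← Real.exp_sub]; ring_nf
    have e6 : Real.exp ((μ - 2 * ν) * y) = Real.exp (μ * y) / Real.exp (ν * y) ^ 2 := by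
      rw [← e4, ← Real.exp_sub]; ring_nf
    simp only [id, Pi.pow_apply, Pi.mul_apply]
    rw [e1, e2, e3, e4, e5, e6]
    have := Real.exp_pos (μ * y)
    have := Real.exp_pos (ν * y)
    generalize Real.exp (μ * y) = X at *
    generalize Real.exp (ν * y) = Y at *
    field_simp
    push_cast
    ring
  · exact ((h1.add h0).add (h1.add h0).comp_neg).integrableOn
  · exact (((RightExpGrowth.exp _).mul hK).mul_decay hdec).const_mul _

/-! ### The integral formula as a heat evolution -/

theorem RightExpGrowth.const_add_id (c : ℝ) : RightExpGrowth fun y => c + y :=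
  (RightExpGrowth.const c).add ⟨1, 1, zero_le_one, zero_le_one, fun y hy => by
    rw [abs_of_nonneg hy, one_mul, one_mul]
    linarith [Real.add_one_le_exp y]⟩

theorem rightExpDecay_Psi_drift {t : ℝ} (ht : 0 < t) (k x : ℝ) :
    RightExpDecay fun y => Psi ((x + y + k * t) / Real.sqrt t) := by
  have h := rightExpDecay_Psi (Real.sqrt_pos.2 ht) (x + k * t)
  simp_rw [add_right_comm x (k * t)] at h
  exact h

theorem rightExpDecay_phi_drift {t : ℝ} (ht : 0 < t) (k x : ℝ) :
    RightExpDecay fun y => phi ((x + y + k * t) / Real.sqrt t) := by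
  have h := rightExpDecay_phi (Real.sqrt_pos.2 ht) (x + k * t)
  simp_rw [add_right_comm x (k * t)] at h
  exact h

theorem hasDerivAt_Psi_drift (t k x y : ℝ) :
    HasDerivAt (fun y => Psi ((x + y + k * t) / Real.sqrt t))
      (-(1 / Real.sqrt t * phi ((x + y + k * t) / Real.sqrt t))) y := by
  have h := (hasDerivAt_Psi ((x + y + k * t) / Real.sqrt t)).comp y
    ((((hasDerivAt_id y).const_add x).add_const (k * t)).div_const (Real.sqrt t))
  refine h.congr_deriv ?_
  ring

theorem exp_mul_phi_drift {t : ℝ} (ht : 0 < t) (μ ν x y : ℝ) :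
    Real.exp (-2 * (ν - μ) * y) * phi ((x + y + μ * t) / Real.sqrt t) =
      Real.exp (2 * (ν - μ) * (x + ν * t)) *
        phi ((x + y + (2 * ν - μ) * t) / Real.sqrt t) := by
  simp only [phi, div_pow, Real.sq_sqrt ht.le]
  rw [mul_left_comm, ← Real.exp_add, mul_left_comm, ← Real.exp_add]
  congr 2
  field_simp
  ring

/-- `H` expressed through a primitive of `e^{-2(ν-μ)y} Ψ((x+y+μt)/√t)`, without case distinction. -/
theorem exists_primitive_Hker (μ ν : ℝ) {t : ℝ} (ht : 0 < t) (x : ℝ) :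
    ∃ R : ℝ → ℝ,
      (∀ y, HasDerivAt R
        (-(Real.exp (-2 * (ν - μ) * y) * Psi ((x + y + μ * t) / Real.sqrt t))) y) ∧
      RightExpDecay R ∧
      ∀ y, Hker μ ν t x y = 2 * Real.exp (2 * μ * y) * Psi ((x + y + μ * t) / Real.sqrt t) -
        2 * (2 * ν - μ) * Real.exp (2 * ν * y) * R y := by
  have hs := Real.sqrt_pos.2 ht
  have hT := rightExpDecay_Psi_drift ht μ x
  by_cases h : ν = μ
  · subst h
    refine ⟨fun y => Real.sqrt t * phi ((x + y + ν * t) / Real.sqrt t) -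
      (x + ν * t + y) * Psi ((x + y + ν * t) / Real.sqrt t), fun y => ?_,
      ((rightExpDecay_phi_drift ht ν x).const_mul _).sub
        ((RightExpGrowth.const_add_id _).mul_decay hT), fun y => ?_⟩
    · have h1 := ((hasDerivAt_phi ((x + y + ν * t) / Real.sqrt t)).comp y
        ((((hasDerivAt_id y).const_add x).add_const (ν * t)).div_const
          (Real.sqrt t))).const_mul (Real.sqrt t)
      have h2 := ((hasDerivAt_id y).const_add (x + ν * t)).mul (hasDerivAt_Psi_drift t ν x y)
      refine (h1.sub h2).congr_deriv ?_
      simp only [id, sub_self, mul_zero, zero_mul, Real.exp_zero]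
      field_simp
      ring
    · rw [Hker, if_pos rfl]
      ring
  · have hδ : ν - μ ≠ 0 := sub_ne_zero.2 h
    refine ⟨fun y => 1 / (2 * (ν - μ)) *
      (Real.exp (-2 * (ν - μ) * y) * Psi ((x + y + μ * t) / Real.sqrt t) -
        Real.exp (2 * (ν - μ) * (x + ν * t)) *
          Psi ((x + y + (2 * ν - μ) * t) / Real.sqrt t)), fun y => ?_,
      (((RightExpGrowth.exp _).mul_decay hT).sub
        ((rightExpDecay_Psi_drift ht (2 * ν - μ) x).const_mul _)).const_mul _, fun y => ?_⟩
    · have h1 := ((((hasDerivAt_id y).const_mul (-2 * (ν - μ))).exp.mul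
        (hasDerivAt_Psi_drift t μ x y)).sub ((hasDerivAt_Psi_drift t (2 * ν - μ) x y).const_mul
          (Real.exp (2 * (ν - μ) * (x + ν * t))))).const_mul (1 / (2 * (ν - μ)))
      refine h1.congr_deriv ?_
      have h2 := exp_mul_phi_drift ht μ ν x y
      simp only [id]
      generalize Real.exp (-2 * (ν - μ) * y) = E at h2 ⊢
      generalize phi ((x + y + (2 * ν - μ) * t) / Real.sqrt t) = p at h2 ⊢
      field_simp
      linear_combination (-1) * h2
    · rw [Hker, if_neg h]
      beta_reduce
      have e1 : Real.exp (2 * (ν - μ) * (x + y + ν * t)) = Real.exp (2 * ν * y) *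
          Real.exp (2 * (ν - μ) * (x + ν * t)) / Real.exp (2 * μ * y) := by
        rw [← Real.exp_add, ← Real.exp_sub]; ring_nf
      have e2 : Real.exp (-2 * (ν - μ) * y) =
          Real.exp (2 * μ * y) / Real.exp (2 * ν * y) := by
        rw [← Real.exp_sub]; ring_nf
      rw [e1, e2]
      have := Real.exp_pos (2 * μ * y)
      have := Real.exp_pos (2 * ν * y)
      field_simp
      ring

theorem integral_Gker_sub_integral_Hker (μ ν : ℝ) {D g : ℝ → ℝ} (hD : Continuous D) {C : ℝ}
    (hC : ∀ y, |D y| ≤ C) (hg : ∀ z, HasDerivAt g (extSlope μ ν D z) z)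
    (hgb : LeftExpGrowth g) {t : ℝ} (ht : 0 < t) (x : ℝ) :
    (∫ y in Ioi 0, g y * Gker μ t x y) - ∫ y in Ioi 0, D y * Hker μ ν t x y =
      heatEv g t (x + μ * t) := by
  obtain ⟨R, hR, hRdec, hH⟩ := exists_primitive_Hker μ ν ht x
  have hs := Real.sqrt_pos.2 ht
  have hgc : Continuous g := continuous_iff_continuousAt.2 fun z => (hg z).continuousAt
  have hRc : Continuous R := continuous_iff_continuousAt.2 fun z => (hR z).continuousAt
  have hPc : Continuous Psi :=
    continuous_iff_continuousAt.2 fun z => (hasDerivAt_Psi z).continuousAt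
  have hDb : RightExpGrowth D := .of_abs_le fun y _ => hC y
  have hK : RightExpGrowth (expPrimitive ν D) :=
    rightExpGrowth_primitive ((RightExpGrowth.exp (2 * ν)).mul hDb)
  have hT := rightExpDecay_Psi_drift ht μ x
  have hp := rightExpDecay_phi_drift ht μ x
  have hp' : RightExpDecay fun y => phi ((x - y + μ * t) / Real.sqrt t) := by
    convert rightExpDecay_phi hs (-(x + μ * t)) using 2 with y
    rw [phi, phi, ← neg_sq]
    ring_nf
  have hGint : IntegrableOn (fun y => g y * Gker μ t x y) (Ioi 0) := by
    unfold Gker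
    exact (hgb.right.mul_decay (((((RightExpGrowth.exp _).mul_decay hp).add hp').const_mul _).sub
      (((RightExpGrowth.const _).mul (.exp _)).mul_decay hT))).integrableOn (by fun_prop)
  have hHint : IntegrableOn (fun y => D y * Hker μ ν t x y) (Ioi 0) := by
    simp only [hH]
    exact (hDb.mul_decay ((((RightExpGrowth.const _).mul (.exp _)).mul_decay hT).sub
      (((RightExpGrowth.const _).mul (.exp _)).mul_decay hRdec))).integrableOn (by fun_prop)
  have hEint : Integrable fun z =>
      g z * (1 / Real.sqrt t * phi ((x + μ * t - z) / Real.sqrt t)) := by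
    have hpos : 0 < ((((x + μ * t) / t, 1 / (2 * t)) : ℝ × ℝ)).2 := by positivity
    refine ((integrable_gaussMoment hgc hgb 0 hpos).const_mul
      (heatFactor t (x + μ * t))).congr (ae_of_all _ fun z => ?_)
    simp only [heatKernel_eq ht]
    ring
  have hA : ∀ y, 0 ≤ y → HasDerivAt (fun y =>
      -(g y * Real.exp (2 * μ * y) * Psi ((x + y + μ * t) / Real.sqrt t)) +
        g (-y) * Psi ((x + y + μ * t) / Real.sqrt t) +
        2 * (2 * ν - μ) * (expPrimitive ν D y * R y))
      (g y * Gker μ t x y - D y * Hker μ ν t x y -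
        (g y * (1 / Real.sqrt t * phi ((x + μ * t - y) / Real.sqrt t)) +
        g (-y) * (1 / Real.sqrt t * phi ((x + μ * t - -y) / Real.sqrt t)))) y := by
    intro y hy
    have hTd := hasDerivAt_Psi_drift t μ x y
    have h1 := (((hg y).mul ((hasDerivAt_id y).const_mul (2 * μ)).exp).mul hTd).neg
    have h2 := ((hg (-y)).comp y (hasDerivAt_neg y)).mul hTd
    have h3 := ((hasDerivAt_expPrimitive ν hD y).mul (hR y)).const_mul (2 * (2 * ν - μ))
    refine ((h1.add h2).add h3).congr_deriv ?_
    rw [extSlope_of_nonneg μ ν D hy, extSlope_neg μ ν D hy, hH, Gker,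
      show x + μ * t - y = x - y + μ * t by ring, show x + μ * t - -y = x + y + μ * t by ring]
    simp only [id, Pi.mul_apply, Function.comp]
    ring
  have hfin := integral_Ioi_eq_neg_of_decay hA
    ((hGint.sub hHint).sub (hEint.add hEint.comp_neg).integrableOn)
    (((((hgb.right.mul (.exp _)).mul_decay hT).const_mul (-1)).add
      (hgb.neg_right.mul_decay hT)).add ((hK.mul_decay hRdec).const_mul _) |> fun h => by
        simpa only [neg_one_mul] using h)
  rw [heatEv_eq_integral g ht, integral_eq_integral_Ioi_add_neg hEint,
    ← integral_sub hGint hHint, ← sub_eq_zero]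
  refine ((integral_sub (hGint.sub hHint)
    (hEint.add hEint.comp_neg).integrableOn).symm.trans hfin).trans ?_
  simp [expPrimitive_zero]

/-! ### The main theorem -/

theorem eq_add_integral_derivWithin_Ici {f : ℝ → ℝ} (hf : ContDiffOn ℝ 1 f (Ici 0)) {z : ℝ}
    (hz : 0 ≤ z) : f z = f 0 + ∫ y in (0 : ℝ)..z, derivWithin f (Ici 0) y := by
  have hcont := hf.continuousOn_derivWithin (uniqueDiffOn_Ici 0) le_rfl
  have hsub : uIcc 0 z ⊆ Ici 0 := by
    rw [uIcc_of_le hz]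
    exact Icc_subset_Ici_self
  rw [intervalIntegral.integral_eq_sub_of_hasDeriv_right_of_le hz
    (hf.continuousOn.mono Icc_subset_Ici_self) (fun y hy => ?_)
    (hcont.mono hsub).intervalIntegrable]
  · ring
  · exact ((hf.differentiableOn one_ne_zero y hy.1.le).hasDerivWithinAt).mono
      fun w hw => (hy.1.trans hw).le

/-- the integral formula built from the kernels `G` and `H`
defines a solution of the Stroock–Williams problem. -/
theorem stroock_williams_integral_formula_solves (μ ν : ℝ) (f : ℝ → ℝ)
    (hf : IsInitialData f) (u : ℝ → ℝ → ℝ)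
    (hu0 : ∀ x ≥ (0 : ℝ), u 0 x = f x)
    (hu : ∀ t > (0 : ℝ), ∀ x ≥ (0 : ℝ),
      u t x = (∫ y in Set.Ioi (0 : ℝ), f y * Gker μ t x y) -
        ∫ y in Set.Ioi (0 : ℝ), derivWithin f (Set.Ici 0) y * Hker μ ν t x y) :
    IsSWSolution μ ν f u := by
  obtain ⟨hf1, ⟨C, hC⟩, hf0⟩ := hf
  set D : ℝ → ℝ := fun y => derivWithin f (Ici 0) (max y 0) with hDdef
  have hD : Continuous D :=
    (hf1.continuousOn_derivWithin (uniqueDiffOn_Ici 0) le_rfl).comp_continuous (by fun_prop)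
      fun y => mem_Ici.2 (le_max_right y 0)
  have hDC : ∀ y, |D y| ≤ C := fun y => (hC _ (le_max_right y 0)).2
  have hDeq : ∀ y, 0 ≤ y → D y = derivWithin f (Ici 0) y := fun y hy => by simp [hDdef, hy]
  have hg'c := continuous_extSlope μ ν hD
  have hg'b := leftExpGrowth_extSlope μ ν hDC
  set g' := extSlope μ ν D with hg'def
  set g : ℝ → ℝ := fun z => f 0 + ∫ y in (0 : ℝ)..z, g' y with hgdef
  have hg : ∀ z, HasDerivAt g (g' z) z := fun z =>
    (hg'c.integral_hasStrictDerivAt 0 z).hasDerivAt.const_add _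
  have hgf : ∀ z, 0 ≤ z → g z = f z := fun z hz => by
    rw [eq_add_integral_derivWithin_Ici hf1 hz, hgdef]
    refine congrArg (f 0 + ·) (intervalIntegral.integral_congr fun y hy => ?_)
    rw [uIcc_of_le hz] at hy
    exact (extSlope_of_nonneg μ ν D hy.1).trans (hDeq y hy.1)
  have hgb : LeftExpGrowth g := leftExpGrowth_of_hasDerivAt hg hg'c hg'b (C := C)
    fun z hz => by rw [hgf z hz]; exact (hC z hz).1
  have hgc : Continuous g := continuous_iff_continuousAt.2 fun z => (hg z).continuousAt
  have hU : ∀ t, 0 ≤ t → ∀ x, 0 ≤ x → u t x = heatEv g t (x + μ * t) := by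
    intro t ht x hx
    rcases ht.eq_or_lt with rfl | ht
    · rw [hu0 x hx, mul_zero, add_zero, heatEv_zero, hgf x hx]
    · rw [hu t ht x hx, ← integral_Gker_sub_integral_Hker μ ν hD hDC hg hgb ht x]
      congr 1
      · exact setIntegral_congr_fun measurableSet_Ioi fun y hy => by
          simp only [hgf y (le_of_lt hy)]
      · exact setIntegral_congr_fun measurableSet_Ioi fun y hy => by
          simp only [hDeq y (le_of_lt hy)]
  have hUx : ∀ t, 0 ≤ t → ∀ x, 0 ≤ x → ux u t x = heatEv g' t (x + μ * t) := by
    intro t ht x hx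
    have h := (hasDerivAt_heatEv hg hg'c hgb hg'b t (x + μ * t)).comp_add_const x (μ * t)
    exact (h.hasDerivWithinAt.congr (fun y hy => hU t ht y hy) (hU t ht x hx)).derivWithin
      (uniqueDiffOn_Ici 0 x hx)
  have hUxx : ∀ t, 0 < t → ∀ x, 0 ≤ x → HasDerivAt (heatEv g' t) (uxx u t x) (x + μ * t) := by
    intro t ht x hx
    have h := hasDerivAt_heatEv_right hg'c hg'b ht (x + μ * t)
    have h' := (((h.comp_add_const x (μ * t)).hasDerivWithinAt (s := Ici 0)).congr
      (fun y hy => hUx t ht.le y hy) (hUx t ht.le x hx)).derivWithin (uniqueDiffOn_Ici 0 x hx)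
    rwa [← h'] at h
  have hpde : ∀ t > (0 : ℝ), ∀ x ≥ (0 : ℝ),
      ut u t x = μ * ux u t x + (1 / 2) * uxx u t x := by
    intro t ht x hx
    have hm : HasDerivAt (fun s => x + μ * s) μ t := by
      simpa using ((hasDerivAt_id t).const_mul μ).const_add x
    have h := hasDerivAt_heatEv_moving hg hg'c hgb hg'b ht hm (hUxx t ht x hx)
    rw [hUx t ht.le x hx]
    exact (h.congr_of_eventuallyEq ((eventually_gt_nhds ht).mono fun s hs =>
      hU s (le_of_lt hs) x hx)).deriv
  have hcont : ∀ {h : ℝ → ℝ}, Continuous h → LeftExpGrowth h →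
      Continuous fun p : ℝ × ℝ => heatEv h p.1 (p.2 + μ * p.1) := fun hh hb =>
    (continuous_heatEv hh hb).comp (f := fun p : ℝ × ℝ => (p.1, p.2 + μ * p.1)) (by fun_prop)
  refine ⟨?_, fun T hT => ⟨?_, ?_, ?_⟩, fun t ht => ?_, hpde, hu0, fun t ht => ?_⟩
  · refine ((contDiffOn_heatEv hgc hgb).comp (s := Ioi 0 ×ˢ Ici 0)
      (f := fun p : ℝ × ℝ => (p.1, p.2 + μ * p.1)) (by fun_prop) fun p hp => hp.1).congr
      fun p hp => hU p.1 (le_of_lt hp.1) p.2 hp.2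
  · exact (hcont hgc hgb).continuousOn.congr fun p hp => hU p.1 hp.1.1 p.2 hp.2
  · exact (hcont hg'c hg'b).continuousOn.congr fun p hp => hUx p.1 hp.1.1 p.2 hp.2
  · obtain ⟨C₁, h₁⟩ := exists_abs_heatEv_le hgb (|μ| * T) (Real.sqrt T)
    obtain ⟨C₂, h₂⟩ := exists_abs_heatEv_le hg'b (|μ| * T) (Real.sqrt T)
    refine ⟨max C₁ C₂, fun p hp => ?_⟩
    have hm : -(p.2 + μ * p.1) ≤ |μ| * T := by
      have h3 : -μ * p.1 ≤ |μ| * T :=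
        mul_le_mul (neg_le_abs μ) hp.1.2 hp.1.1 (abs_nonneg μ)
      have h4 : 0 ≤ p.2 := hp.2
      linarith
    rw [hU p.1 hp.1.1 p.2 hp.2, hUx p.1 hp.1.1 p.2 hp.2]
    exact ⟨(h₁ _ _ hm (Real.sqrt_le_sqrt hp.1.2)).trans (le_max_left _ _),
      (h₂ _ _ hm (Real.sqrt_le_sqrt hp.1.2)).trans (le_max_right _ _)⟩
  · have hg0 : Tendsto g atTop (nhds 0) :=
      hf0.congr' ((eventually_ge_atTop 0).mono fun z hz => (hgf z hz).symm)
    exact ((tendsto_heatEv_atTop hgc hgb hg0 t).comp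
      (tendsto_atTop_add_const_right atTop (μ * t) tendsto_id)).congr'
      ((eventually_ge_atTop 0).mono fun x hx => (hU t (le_of_lt ht) x hx).symm)
  · have hxx := (hUxx t ht 0 le_rfl).unique
      (hasDerivAt_heatEv_right hg'c hg'b ht (0 + μ * t))
    have hx := heatEv_eq_gaussMoment g' ht (0 + μ * t)
    have hrobin := robin_gaussMoment_extSlope μ ν hD hDC ht
    rw [zero_add, mul_div_cancel_right₀ μ (ne_of_gt ht)] at hxx hx
    rw [hpde t ht 0 le_rfl, hUx t (le_of_lt ht) 0 le_rfl, zero_add, hxx, hx]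
    have : (0 : ℝ) < t := ht
    rw [← hg'def] at hrobin
    generalize heatFactor t (μ * t) = c
    field_simp at hrobin ⊢
    linear_combination c * hrobin
end
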